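/- Suppose the delayed mass-action system is a DeCBMAS and the network is a combination of ℓ subnetworks each of which is a 2d sub-DeCBMAS. Let W be a semilocking set of the combined network in Case III with W^{cv} = ∅ and W ∩ S_c = ∅. Then no ω-limit point of any bounded solution with positive initial condition lies on the boundary L_W. -/

import Mathlib

open Finset Filter

variable {n r : ℕ}

/-- Mass-action monomial `x^y = ∏ j, x j ^ y j`. -/
def mono (x : Fin n → ℝ) (y : Fin n → ℕ) : ℝ := ∏ j, x j ^ y j

/-- A (bounded-domain) solution of the delayed mass-action system whose reactions are
those in the index set `R` (with reactant complexes `y`, product complexes `y'`,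
rate constants `k`, delays `τ`, and maximal delay `τm`):
nonnegative, continuous on `[-τm, ∞)`, and satisfying the delay differential equation
`x'(t) = ∑ i ∈ R, k i (x(t-τ i)^{y i} • y' i - x(t)^{y i} • y i)` for `t > 0`. -/
def IsSolutionOn (y y' : Fin r → Fin n → ℕ) (k τ : Fin r → ℝ) (τm : ℝ)
    (R : Finset (Fin r)) (x : ℝ → Fin n → ℝ) : Prop :=
  (∀ t ∈ Set.Ici (-τm), ∀ j, 0 ≤ x t j) ∧
  ContinuousOn x (Set.Ici (-τm)) ∧
  ∀ t > (0 : ℝ), HasDerivAt x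
    (fun j => ∑ i ∈ R, k i * (mono (x (t - τ i)) (y i) * (y' i j : ℝ)
      - mono (x t) (y i) * (y i j : ℝ))) t

/-- A solution of the full delayed mass-action system. -/
def IsSolution (y y' : Fin r → Fin n → ℕ) (k τ : Fin r → ℝ) (τm : ℝ)
    (x : ℝ → Fin n → ℝ) : Prop :=
  IsSolutionOn y y' k τ τm Finset.univ x

/-- Positive initial condition: `x` is strictly positive on `[-τm, 0]`. -/
def PosInit (τm : ℝ) (x : ℝ → Fin n → ℝ) : Prop :=
  ∀ t ∈ Set.Icc (-τm) 0, ∀ j, 0 < x t j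

/-- The solution is bounded on `[-τm, ∞)`. -/
def BoundedSol (τm : ℝ) (x : ℝ → Fin n → ℝ) : Prop :=
  ∃ M : ℝ, ∀ t ∈ Set.Ici (-τm), ‖x t‖ ≤ M

/-- The (sub)system consisting of the reactions in `R` is complex balanced:
there is a positive state `xb` at which, for every complex `η`, the inflow and
outflow rates of `η` coincide. -/
def ComplexBalancedOn (y y' : Fin r → Fin n → ℕ) (k : Fin r → ℝ)
    (R : Finset (Fin r)) : Prop :=
  ∃ xb : Fin n → ℝ, (∀ j, 0 < xb j) ∧ ∀ η : Fin n → ℕ,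
    ∑ i ∈ R.filter (fun i => y i = η), k i * mono xb (y i)
      = ∑ i ∈ R.filter (fun i => y' i = η), k i * mono xb (y i)

/-- `W` is a semilocking set for the reactions in `R`. -/
def Semilocking (y y' : Fin r → Fin n → ℕ) (R : Finset (Fin r)) (W : Set (Fin n)) : Prop :=
  W.Nonempty ∧ ∀ i ∈ R, (∃ j ∈ W, y' i j ≠ 0) → ∃ j ∈ W, y i j ≠ 0

/-- Stoichiometric subspace spanned by the reaction vectors of the reactions in `R`. -/
def stoichOn (y y' : Fin r → Fin n → ℕ) (R : Finset (Fin r)) : Submodule ℝ (Fin n → ℝ) :=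
  Submodule.span ℝ {v | ∃ i ∈ R, v = fun j => (y' i j : ℝ) - (y i j : ℝ)}

/-- `W` is vertex-type w.r.t. the subspace `V`: the only `v ∈ V` vanishing on `W` is `0`. -/
def VertexType (V : Submodule ℝ (Fin n → ℝ)) (W : Set (Fin n)) : Prop :=
  ∀ v ∈ V, (∀ j ∈ W, v j = 0) → v = 0

/-- `W` is facet-type w.r.t. the subspace `V`: the projection of `V` onto the
coordinates outside `W` has dimension `dim V - 1`. -/
def FacetType (V : Submodule ℝ (Fin n → ℝ)) (W : Set (Fin n)) : Prop :=
  Module.finrank ℝ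
      (V.map (LinearMap.funLeft ℝ ℝ (Subtype.val : {j : Fin n // j ∉ W} → Fin n)))
    = Module.finrank ℝ V - 1

/-- The network is a combination of subnetworks with species sets `Sp p` and with
reaction `i` assigned to subnetwork `grp i`. -/
def IsCombination {l : ℕ} (y y' : Fin r → Fin n → ℕ) (Sp : Fin l → Set (Fin n))
    (grp : Fin r → Fin l) : Prop :=
  (∀ j, ∃ p, j ∈ Sp p) ∧ ∀ i j, (y i j ≠ 0 ∨ y' i j ≠ 0) → j ∈ Sp (grp i)

/-- The reaction index set of subnetwork `p`. -/
def Rgrp {l : ℕ} (grp : Fin r → Fin l) (p : Fin l) : Finset (Fin r) :=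
  Finset.univ.filter (fun i => grp i = p)

/-- The set `S_c` of intersecting species. -/
def interSpecies {l : ℕ} (Sp : Fin l → Set (Fin n)) : Set (Fin n) :=
  {j | ∃ p q, p ≠ q ∧ j ∈ Sp p ∧ j ∈ Sp q}

/-- `W^{cn}`: species outside `W` lying in some subnetwork `p'` with `W ∩ S^(p') = ∅`. -/
def Wcn {l : ℕ} (Sp : Fin l → Set (Fin n)) (W : Set (Fin n)) : Set (Fin n) :=
  {j | j ∉ W ∧ ∃ p, W ∩ Sp p = ∅ ∧ j ∈ Sp p}

/-- `W^{tf}`: completely unrestricted species outside `W`: they occur in some reaction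
all of whose species lie outside `W`. -/
def Wtf (y y' : Fin r → Fin n → ℕ) (W : Set (Fin n)) : Set (Fin n) :=
  {j | j ∉ W ∧ ∃ i, (y i j ≠ 0 ∨ y' i j ≠ 0) ∧
    ∀ j', (y i j' ≠ 0 ∨ y' i j' ≠ 0) → j' ∉ W}

/-- `W^{tr}`: totally restricted species outside `W`: every stoichiometric vector
vanishing on `W` also vanishes at `j`. -/
def Wtr (y y' : Fin r → Fin n → ℕ) (W : Set (Fin n)) : Set (Fin n) :=
  {j | j ∉ W ∧ ∀ v ∈ stoichOn y y' Finset.univ, (∀ j' ∈ W, v j' = 0) → v j = 0}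

/-- `θ` (a function on `[-τm,0]`) is an ω-limit point of the solution `x`. -/
def OmegaLimitPt (τm : ℝ) (x θ : ℝ → Fin n → ℝ) : Prop :=
  ContinuousOn θ (Set.Icc (-τm) 0) ∧ (∀ s ∈ Set.Icc (-τm) 0, ∀ j, 0 ≤ θ s j) ∧
  ∃ tN : ℕ → ℝ, Tendsto tN atTop atTop ∧
    ∀ ε > (0 : ℝ), ∃ N₀, ∀ N ≥ N₀, ∀ s ∈ Set.Icc (-τm) 0, ‖x (tN N + s) - θ s‖ < ε

/-- `θ` lies on the boundary `L_W`: it vanishes identically on the coordinates of `W`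
and is nowhere zero on the coordinates outside `W`. -/
def OnBoundary (τm : ℝ) (W : Set (Fin n)) (θ : ℝ → Fin n → ℝ) : Prop :=
  (∀ s ∈ Set.Icc (-τm) 0, ∀ j ∈ W, θ s j = 0) ∧
  ∀ s ∈ Set.Icc (-τm) 0, ∀ j ∉ W, θ s j ≠ 0

/-- Persistence of the delayed mass-action system: every bounded solution with
positive initial condition has `liminf_{t→∞} x_j(t) > 0` for every species `j`. -/
def Persistent (y y' : Fin r → Fin n → ℕ) (k τ : Fin r → ℝ) (τm : ℝ) : Prop :=
  ∀ x : ℝ → Fin n → ℝ, IsSolution y y' k τ τm x → PosInit τm x → BoundedSol τm x →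
    ∀ j, 0 < liminf (fun t => x t j) atTop


theorem exists_unif {ι : Type*} [Fintype ι] {P : ι → ℝ → Prop}
    (hm : ∀ i L L', L ≤ L' → P i L → P i L') (h : ∀ i, ∃ L, P i L) :
    ∃ L, 1 ≤ L ∧ ∀ i, P i L := by
  choose f hf using h
  refine ⟨1 + ∑ i, |f i|, ?_, fun i => hm i (f i) _ ?_ (hf i)⟩
  · have : 0 ≤ ∑ i, |f i| := Finset.sum_nonneg (fun i _ => abs_nonneg _)
    linarith
  · have : |f i| ≤ ∑ i, |f i| :=
      Finset.single_le_sum (f := fun i => |f i|) (fun i _ => abs_nonneg _) (Finset.mem_univ i)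
    have := le_abs_self (f i)
    linarith

theorem mono_pos' (u : Fin n → ℝ) (y : Fin n → ℕ) (h : ∀ j, 0 < u j) : 0 < mono u y :=
  Finset.prod_pos (fun j _ => pow_pos (h j) _)

theorem mono_log (u : Fin n → ℝ) (y : Fin n → ℕ) (h : ∀ j, 0 < u j) :
    Real.log (mono u y) = ∑ j, (y j : ℝ) * Real.log (u j) := by
  unfold mono
  rw [Real.log_prod (fun j _ => (pow_pos (h j) _).ne')]
  simp [Real.log_pow]

theorem mono_cont (u : ℝ → Fin n → ℝ) (y : Fin n → ℕ) (h : ∀ j, Continuous (fun t => u t j)) :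
    Continuous (fun t => mono (u t) y) := by
  unfold mono
  exact continuous_finsetProd _ (fun j _ => (h j).pow _)

theorem pow_lip (B : ℝ) (hB : 1 ≤ B) (k : ℕ) : ∃ L, 0 ≤ L ∧ ∀ a b d : ℝ, 0 ≤ a → a ≤ B → 0 ≤ b →
    b ≤ B → |a - b| ≤ d → |a ^ k - b ^ k| ≤ L * d := by
  induction k with
  | zero => exact ⟨0, le_rfl, fun a b d _ _ _ _ _ => by simp⟩
  | succ k ih =>
    obtain ⟨L, hL0, hL⟩ := ih
    refine ⟨L * B + B ^ k, by positivity, fun a b d ha haB hb hbB hd => ?_⟩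
    have e : a ^ (k+1) - b ^ (k+1) = (a ^ k - b ^ k) * a + b ^ k * (a - b) := by ring
    rw [e]
    have h1 := hL a b d ha haB hb hbB hd
    have hd0 : 0 ≤ d := (abs_nonneg _).trans hd
    calc |(a ^ k - b ^ k) * a + b ^ k * (a - b)| ≤ |(a ^ k - b ^ k) * a| + |b ^ k * (a - b)| := abs_add_le _ _
      _ = |a ^ k - b ^ k| * a + b ^ k * |a - b| := by
          rw [abs_mul, abs_mul, abs_of_nonneg ha, abs_of_nonneg (pow_nonneg hb k)]
      _ ≤ (L * d) * B + B ^ k * d := by gcongr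
      _ = _ := by ring

theorem prod_lip (B : ℝ) (hB : 1 ≤ B) (y : Fin n → ℕ) (s : Finset (Fin n)) :
    ∃ L, 0 ≤ L ∧ ∀ u v : Fin n → ℝ, ∀ d : ℝ, (∀ j, 0 ≤ u j) → (∀ j, u j ≤ B) → (∀ j, 0 ≤ v j) →
    (∀ j, v j ≤ B) → (0 ≤ d) → (∀ j, |u j - v j| ≤ d) →
    |∏ j ∈ s, u j ^ y j - ∏ j ∈ s, v j ^ y j| ≤ L * d ∧ ∏ j ∈ s, u j ^ y j ≤ L + 1 := by
  classical
  induction s using Finset.induction_on with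
  | empty => exact ⟨0, le_rfl, fun u v d _ _ _ _ _ _ => by simp⟩
  | insert a s ha ih =>
    obtain ⟨L, hL0, hL⟩ := ih
    obtain ⟨L', hL'0, hL'⟩ := pow_lip B hB (y a)
    refine ⟨L' * (L + 1) + B ^ y a * (L + 1), by positivity, fun u v d hu huB hv hvB hd0 hd => ?_⟩
    rw [Finset.prod_insert ha, Finset.prod_insert ha]
    obtain ⟨h1, h2⟩ := hL u v d hu huB hv hvB hd0 hd
    have h3 := hL' (u a) (v a) d (hu a) (huB a) (hv a) (hvB a) (hd a)
    have h4 : v a ^ y a ≤ B ^ y a := pow_le_pow_left₀ (hv a) (hvB a) _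
    have h4' : u a ^ y a ≤ B ^ y a := pow_le_pow_left₀ (hu a) (huB a) _
    have hp : 0 ≤ ∏ j ∈ s, u j ^ y j := Finset.prod_nonneg (fun j _ => pow_nonneg (hu j) _)
    have hva := pow_nonneg (hv a) (y a)
    have hua := pow_nonneg (hu a) (y a)
    set P := ∏ j ∈ s, u j ^ y j
    set P' := ∏ j ∈ s, v j ^ y j
    constructor
    · have e : u a ^ y a * P - v a ^ y a * P' = (u a ^ y a - v a ^ y a) * P + v a ^ y a * (P - P') := by ring
      rw [e]
      calc _ ≤ |(u a ^ y a - v a ^ y a) * P| + |v a ^ y a * (P - P')| := abs_add_le _ _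
        _ = |u a ^ y a - v a ^ y a| * P + v a ^ y a * |P - P'| := by
          rw [abs_mul, abs_mul, abs_of_nonneg hp, abs_of_nonneg hva]
        _ ≤ (L' * d) * (L + 1) + B ^ y a * (L * d) := by gcongr
        _ ≤ _ := by
          have : 0 ≤ B ^ y a * d := by positivity
          nlinarith
    · calc u a ^ y a * P ≤ B ^ y a * (L + 1) := by gcongr
        _ ≤ _ := by
          have : 0 ≤ L' * (L+1) := by positivity
          linarith

/-- uniform Lipschitz constant and bound for monomials -/
theorem mono_lip {ι : Type*} [Fintype ι] (B : ℝ) (hB : 1 ≤ B) (z : ι → Fin n → ℕ) :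
    ∃ L, 1 ≤ L ∧ ∀ i, ∀ u v : Fin n → ℝ, ∀ d : ℝ, (∀ j, 0 ≤ u j) → (∀ j, u j ≤ B) → (∀ j, 0 ≤ v j) →
    (∀ j, v j ≤ B) → (0 ≤ d) → (∀ j, |u j - v j| ≤ d) →
    |mono u (z i) - mono v (z i)| ≤ L * d ∧ mono u (z i) ≤ L := by
  apply exists_unif
  · intro i L L' hLL h u v d h1 h2 h3 h4 h5 h6
    obtain ⟨a, b⟩ := h u v d h1 h2 h3 h4 h5 h6
    exact ⟨a.trans (by gcongr), b.trans hLL⟩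
  · intro i
    obtain ⟨L, hL0, hL⟩ := prod_lip B hB (z i) Finset.univ
    refine ⟨L + 1, fun u v d h1 h2 h3 h4 h5 h6 => ?_⟩
    obtain ⟨a, b⟩ := hL u v d h1 h2 h3 h4 h5 h6
    exact ⟨a.trans (by gcongr; linarith), b⟩

/-- monomials involving `w` are bounded by a multiple of `u w` -/
theorem mono_le_coord {ι : Type*} [Fintype ι] (B : ℝ) (hB : 1 ≤ B) (z : ι → Fin n → ℕ) :
    ∃ L, 1 ≤ L ∧ ∀ i, ∀ u : Fin n → ℝ, ∀ w, (∀ j, 0 ≤ u j) → (∀ j, u j ≤ B) → z i w ≠ 0 →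
    mono u (z i) ≤ L * u w := by
  apply exists_unif
  · intro i L L' hLL h u w h1 h2 h3
    exact (h u w h1 h2 h3).trans (mul_le_mul_of_nonneg_right hLL (h1 w))
  · intro i
    refine ⟨B ^ (∑ j, z i j), fun u w h1 h2 h3 => ?_⟩
    classical
    unfold mono
    rw [← Finset.mul_prod_erase Finset.univ _ (Finset.mem_univ w)]
    rw [← Finset.add_sum_erase Finset.univ _ (Finset.mem_univ w), pow_add, ← Finset.prod_pow_eq_pow_sum]
    obtain ⟨k, hk⟩ := Nat.exists_eq_succ_of_ne_zero h3
    have a1 : u w ^ z i w ≤ B ^ z i w * u w := by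
      rw [hk, Nat.succ_eq_add_one, pow_succ (u w)]
      have : u w ^ k ≤ B ^ k := pow_le_pow_left₀ (h1 w) (h2 w) _
      have : B ^ k ≤ B ^ (k+1) := pow_le_pow_right₀ hB (by omega)
      exact mul_le_mul_of_nonneg_right (by linarith) (h1 w)
    have a2 : ∏ j ∈ Finset.univ.erase w, u j ^ z i j ≤ ∏ j ∈ Finset.univ.erase w, B ^ z i j :=
      Finset.prod_le_prod (fun j _ => pow_nonneg (h1 j) _) (fun j _ => pow_le_pow_left₀ (h1 j) (h2 j) _)
    have a3 : 0 ≤ ∏ j ∈ Finset.univ.erase w, u j ^ z i j := Finset.prod_nonneg (fun j _ => pow_nonneg (h1 j) _)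
    have a4 := h1 w
    calc _ ≤ (B ^ z i w * u w) * ∏ j ∈ Finset.univ.erase w, B ^ z i j := by gcongr
      _ = _ := by ring

/-- entropy function -/
noncomputable def hh (a : ℝ) : ℝ := a * Real.log a - a + 1

noncomputable def h2 (a c : ℝ) : ℝ := a * Real.log a - a * Real.log c - a + c

theorem hh_cont : Continuous hh := by
  unfold hh
  exact (Real.continuous_mul_log.sub continuous_id).add continuous_const

theorem hh_deriv {a : ℝ} (ha : 0 < a) : HasDerivAt hh (Real.log a) a := by
  have := ((Real.hasDerivAt_mul_log ha.ne').sub (hasDerivAt_id a)).add_const 1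
  refine this.congr_deriv ?_
  ring

theorem h2_lower {a c : ℝ} (ha : 0 < a) (hc : 0 < c) {B : ℝ} (haB : a ≤ B) (hcB : c ≤ B) :
    1 / (4 * B) * (a - c) ^ 2 ≤ h2 a c := by
  have hB : 0 < B := ha.trans_le haB
  obtain ⟨p, hp, rfl⟩ : ∃ p, 0 < p ∧ a = p ^ 2 := ⟨√a, Real.sqrt_pos.2 ha, (Real.sq_sqrt ha.le).symm⟩
  obtain ⟨q, hq, rfl⟩ : ∃ p, 0 < p ∧ c = p ^ 2 := ⟨√c, Real.sqrt_pos.2 hc, (Real.sq_sqrt hc.le).symm⟩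
  have h1 : Real.log (q / p) ≤ q / p - 1 := Real.log_le_sub_one_of_pos (by positivity)
  rw [Real.log_div hq.ne' hp.ne'] at h1
  have h3 : p ^ 2 * (Real.log q - Real.log p) ≤ p ^ 2 * (q / p - 1) := by gcongr
  have h4 : p ^ 2 * (q / p - 1) = p * q - p ^ 2 := by field_simp
  have h5 : (p - q) ^ 2 ≤ h2 (p ^ 2) (q ^ 2) := by
    unfold h2
    rw [Real.log_pow, Real.log_pow]
    push_cast
    nlinarith
  refine le_trans ?_ h5
  rw [div_mul_eq_mul_div, one_mul, div_le_iff₀ (by positivity)]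
  have : (p + q) ^ 2 ≤ 4 * B := by nlinarith [sq_nonneg (p - q)]
  calc (p ^ 2 - q ^ 2) ^ 2 = (p - q) ^ 2 * (p + q) ^ 2 := by ring
    _ ≤ _ := by gcongr

theorem h2_nonneg {a c : ℝ} (ha : 0 < a) (hc : 0 < c) : 0 ≤ h2 a c :=
  le_trans (by positivity) (h2_lower ha hc (le_max_left a c) (le_max_right a c))

theorem hh_nonneg {a : ℝ} (ha : 0 < a) : 0 ≤ hh a := by
  have := h2_nonneg ha one_pos
  simpa [h2, hh] using this

theorem hh_le {a : ℝ} (ha : 0 < a) : hh a ≤ (a - 1) ^ 2 := by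
  have := mul_le_mul_of_nonneg_left (Real.log_le_sub_one_of_pos ha) ha.le
  unfold hh
  nlinarith

theorem hasDerivAt_win (f : ℝ → ℝ) (hf : Continuous f) (τ t : ℝ) :
    HasDerivAt (fun t => ∫ s in (t - τ)..t, f s) (f t - f (t - τ)) t := by
  have e : (fun t => ∫ s in (t - τ)..t, f s) =
      fun t => (∫ s in (0:ℝ)..t, f s) - ∫ s in (0:ℝ)..(t - τ), f s := by
    ext t
    rw [intervalIntegral.integral_interval_sub_left (hf.intervalIntegrable _ _) (hf.intervalIntegrable _ _)]
  rw [e]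
  have h1 : ∀ b, HasDerivAt (fun t => ∫ s in (0:ℝ)..t, f s) (f b) b := fun b =>
    intervalIntegral.integral_hasDerivAt_right (hf.intervalIntegrable _ _)
      (hf.stronglyMeasurableAtFilter _ _) hf.continuousAt
  exact (h1 t).sub ((h1 (t - τ)).comp_sub_const t τ)

/-- normalized system -/
structure NS (y y' : Fin r → Fin n → ℕ) (K τ : Fin r → ℝ) (m : Fin n → ℝ) (τm Mb : ℝ)
    (u : ℝ → Fin n → ℝ) : Prop where
  hK : ∀ i, 0 < K i
  hτ : ∀ i, 0 ≤ τ i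
  hτm : ∀ i, τ i ≤ τm
  hτm0 : 0 ≤ τm
  hm : ∀ j, 0 < m j
  bal : ∀ f : (Fin n → ℕ) → ℝ, ∑ i, K i * f (y i) = ∑ i, K i * f (y' i)
  cont : ∀ j, Continuous (fun t => u t j)
  pos : ∀ t j, 0 < u t j
  bdd : ∀ t j, u t j ≤ Mb
  hMb : 1 ≤ Mb
  der : ∀ t > 0, ∀ j, HasDerivAt (fun t => u t j)
    ((∑ i, K i * (mono (u (t - τ i)) (y i) * (y' i j : ℝ) - mono (u t) (y i) * (y i j : ℝ))) / m j) t

noncomputable def Hf (y : Fin r → Fin n → ℕ) (K τ : Fin r → ℝ) (m : Fin n → ℝ)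
    (u : ℝ → Fin n → ℝ) (W : Finset (Fin n)) (A : Finset (Fin r)) (t : ℝ) : ℝ :=
  ∑ j ∈ W, m j * hh (u t j) + ∑ i ∈ A, K i * ∫ s in (t - τ i)..t, hh (mono (u s) (y i))

section NSsec
variable {y y' : Fin r → Fin n → ℕ} {K τ : Fin r → ℝ} {m : Fin n → ℝ} {τm Mb : ℝ}
    {u : ℝ → Fin n → ℝ}

theorem NS.mcont (h : NS y y' K τ m τm Mb u) (z : Fin n → ℕ) : Continuous (fun t => mono (u t) z) :=
  mono_cont u z h.cont

theorem NS.mpos (h : NS y y' K τ m τm Mb u) (z : Fin n → ℕ) (t : ℝ) : 0 < mono (u t) z :=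
  mono_pos' _ _ (h.pos t)

theorem NS.Hf_deriv (h : NS y y' K τ m τm Mb u) (W : Finset (Fin n)) (A : Finset (Fin r))
    (hAW : ∀ i ∉ A, ∀ j ∈ W, y i j = 0 ∧ y' i j = 0) {t : ℝ} (ht : 0 < t)
    (hA : ∑ i ∈ A, K i * mono (u t) (y i) = ∑ i ∈ A, K i * mono (u t) (y' i)) :
    HasDerivAt (Hf y K τ m u W A)
      (-(∑ i ∈ A, K i * h2 (mono (u (t - τ i)) (y i)) (mono (u t) (y' i)))
       - ∑ i ∈ A, K i * (mono (u (t - τ i)) (y i) * (∑ j ∈ Wᶜ, (y' i j : ℝ) * Real.log (u t j))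
         - mono (u t) (y i) * (∑ j ∈ Wᶜ, (y i j : ℝ) * Real.log (u t j)))) t := by
  have d1 : HasDerivAt (fun t => ∑ j ∈ W, m j * hh (u t j))
      (∑ j ∈ W, m j * (Real.log (u t j) * ((∑ i, K i * (mono (u (t - τ i)) (y i) * (y' i j : ℝ) - mono (u t) (y i) * (y i j : ℝ))) / m j))) t := by
    apply HasDerivAt.fun_sum
    intro j _
    exact ((hh_deriv (h.pos t j)).comp t (h.der t ht j)).const_mul (m j)
  have d2 : HasDerivAt (fun t => ∑ i ∈ A, K i * ∫ s in (t - τ i)..t, hh (mono (u s) (y i)))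
      (∑ i ∈ A, K i * (hh (mono (u t) (y i)) - hh (mono (u (t - τ i)) (y i)))) t := by
    apply HasDerivAt.fun_sum
    intro i _
    exact (hasDerivAt_win _ (hh_cont.comp (h.mcont (y i))) (τ i) t).const_mul (K i)
  have d3 := d1.add d2
  refine d3.congr_deriv ?_
  have e1 : ∑ j ∈ W, m j * (Real.log (u t j) * ((∑ i, K i * (mono (u (t - τ i)) (y i) * (y' i j : ℝ) - mono (u t) (y i) * (y i j : ℝ))) / m j))
      = ∑ i ∈ A, K i * (mono (u (t - τ i)) (y i) * (∑ j ∈ W, (y' i j : ℝ) * Real.log (u t j))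
         - mono (u t) (y i) * (∑ j ∈ W, (y i j : ℝ) * Real.log (u t j))) := by
    have : ∀ j ∈ W, m j * (Real.log (u t j) * ((∑ i, K i * (mono (u (t - τ i)) (y i) * (y' i j : ℝ) - mono (u t) (y i) * (y i j : ℝ))) / m j))
       = ∑ i, K i * (mono (u (t - τ i)) (y i) * ((y' i j : ℝ) * Real.log (u t j)) - mono (u t) (y i) * ((y i j : ℝ) * Real.log (u t j))) := by
      intro j _
      have := (h.hm j).ne'
      field_simp
      rw [Finset.mul_sum]
      exact Finset.sum_congr rfl (fun i _ => by ring)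
    rw [Finset.sum_congr rfl this, Finset.sum_comm]
    have e2 : ∀ i, ∑ j ∈ W, K i * (mono (u (t - τ i)) (y i) * ((y' i j : ℝ) * Real.log (u t j)) - mono (u t) (y i) * ((y i j : ℝ) * Real.log (u t j)))
      = K i * (mono (u (t - τ i)) (y i) * (∑ j ∈ W, (y' i j : ℝ) * Real.log (u t j))
         - mono (u t) (y i) * (∑ j ∈ W, (y i j : ℝ) * Real.log (u t j))) := by
      intro i
      rw [← Finset.mul_sum, Finset.sum_sub_distrib, Finset.mul_sum, Finset.mul_sum]
    rw [Finset.sum_congr rfl (fun i _ => e2 i)]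
    symm
    apply Finset.sum_subset (Finset.subset_univ A)
    intro i _ hi
    have z1 : ∑ j ∈ W, (y' i j : ℝ) * Real.log (u t j) = 0 :=
      Finset.sum_eq_zero (fun j hj => by simp [(hAW i hi j hj).2])
    have z2 : ∑ j ∈ W, (y i j : ℝ) * Real.log (u t j) = 0 :=
      Finset.sum_eq_zero (fun j hj => by simp [(hAW i hi j hj).1])
    rw [z1, z2]; ring
  rw [e1, ← Finset.sum_add_distrib]
  have e3 : ∑ i ∈ A, K i * (mono (u t) (y' i) - mono (u t) (y i)) = 0 := by
    simp_rw [mul_sub]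
    rw [Finset.sum_sub_distrib, hA, sub_self]
  rw [← Finset.sum_neg_distrib, ← Finset.sum_sub_distrib]
  rw [← sub_eq_zero, ← Finset.sum_sub_distrib]
  refine Eq.trans ?_ e3
  apply Finset.sum_congr rfl
  intro i _
  have l1 := mono_log (u t) (y' i) (h.pos t)
  have l2 := mono_log (u t) (y i) (h.pos t)
  rw [← Finset.sum_add_sum_compl W] at l1 l2
  unfold h2 hh
  rw [l1]
  simp only [l2]
  ring

end NSsec

theorem decay_gen (f f' : ℝ → ℝ) (a b C : ℝ) (hab : a ≤ b) (hc : ContinuousOn f (Set.Icc a b))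
    (hd : ∀ t ∈ Set.Ioo a b, HasDerivAt f (f' t) t) (hn : ∀ t ∈ Set.Ioo a b, -C * f t ≤ f' t) :
    f a * Real.exp (-C * (b - a)) ≤ f b := by
  have hmono : MonotoneOn (fun t => f t * Real.exp (C * t)) (Set.Icc a b) := by
    apply monotoneOn_of_hasDerivWithinAt_nonneg (f' := fun t => f' t * Real.exp (C * t) + f t * (Real.exp (C * t) * C))
      (convex_Icc a b)
    · exact hc.mul (by fun_prop)
    · intro t ht
      rw [interior_Icc] at ht
      have e : HasDerivAt (fun t => Real.exp (C * t)) (Real.exp (C * t) * C) t := by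
        simpa using ((hasDerivAt_id t).const_mul C).exp
      exact ((hd t ht).mul e).hasDerivWithinAt
    · intro t ht
      rw [interior_Icc] at ht
      have := hn t ht
      have he := Real.exp_pos (C * t)
      nlinarith
  have := hmono (Set.left_mem_Icc.2 hab) (Set.right_mem_Icc.2 hab) hab
  simp only at this
  have e : Real.exp (-C * (b - a)) = Real.exp (C * a) * Real.exp (-(C * b)) := by
    rw [← Real.exp_add]; congr 1; ring
  rw [e]
  calc f a * (Real.exp (C * a) * Real.exp (-(C * b))) = (f a * Real.exp (C * a)) * Real.exp (-(C * b)) := by ring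
    _ ≤ (f b * Real.exp (C * b)) * Real.exp (-(C * b)) := by gcongr
    _ = f b := by rw [mul_assoc, ← Real.exp_add]; simp

theorem sqrt_opt {z T C q : ℝ} (hq : 0 ≤ q) (hT : 0 ≤ T)
    (h : ∀ lam > 0, z ≤ lam * T + C / lam * q) : z ≤ (T + C) * √q := by
  rcases hq.eq_or_lt with rfl | hq
  · simp only [Real.sqrt_zero, mul_zero]
    apply le_of_forall_pos_le_add
    intro ε hε
    have := h (ε / (T + 1)) (by positivity)
    have h2 : ε / (T + 1) * T ≤ ε := by
      rw [div_mul_eq_mul_div, div_le_iff₀ (by positivity)]; nlinarith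
    linarith
  · have hs := Real.sqrt_pos.2 hq
    have := h (√q) hs
    have e : C / √q * q = C * √q := by
      nth_rewrite 2 [← Real.mul_self_sqrt hq.le]
      field_simp
    rw [e] at this
    linarith

section NSsec2
variable {y y' : Fin r → Fin n → ℕ} {K τ : Fin r → ℝ} {m : Fin n → ℝ} {τm Mb : ℝ}
    {u : ℝ → Fin n → ℝ}

theorem NS.V_deriv (h : NS y y' K τ m τm Mb u) {t : ℝ} (ht : 0 < t) :
    HasDerivAt (Hf y K τ m u univ univ)
      (-(∑ i, K i * h2 (mono (u (t - τ i)) (y i)) (mono (u t) (y' i)))) t := by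
  have := h.Hf_deriv univ univ (by simp) ht (h.bal (fun z => mono (u t) z))
  simpa using this

theorem NS.Hf_nonneg (h : NS y y' K τ m τm Mb u) (W : Finset (Fin n)) (A : Finset (Fin r)) (t : ℝ) :
    0 ≤ Hf y K τ m u W A t := by
  unfold Hf
  apply add_nonneg
  · exact Finset.sum_nonneg (fun j _ => mul_nonneg (h.hm j).le (hh_nonneg (h.pos t j)))
  · refine Finset.sum_nonneg (fun i _ => mul_nonneg (h.hK i).le ?_)
    exact intervalIntegral.integral_nonneg (by linarith [h.hτ i]) (fun s _ => hh_nonneg (h.mpos _ s))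

theorem NS.V_anti (h : NS y y' K τ m τm Mb u) : AntitoneOn (Hf y K τ m u univ univ) (Set.Ioi 0) := by
  apply antitoneOn_of_hasDerivWithinAt_nonpos (convex_Ioi 0)
    (f' := fun t => -(∑ i, K i * h2 (mono (u (t - τ i)) (y i)) (mono (u t) (y' i))))
  · exact fun t ht => (h.V_deriv ht).continuousAt.continuousWithinAt
  · intro t ht
    rw [interior_Ioi] at ht
    exact (h.V_deriv ht).hasDerivWithinAt
  · intro t _
    rw [neg_nonpos]
    exact Finset.sum_nonneg (fun i _ => mul_nonneg (h.hK i).le (h2_nonneg (h.mpos _ _) (h.mpos _ _)))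

theorem NS.lip (h : NS y y' K τ m τm Mb u) : ∃ L, 1 ≤ L ∧ ∀ a b d : ℝ, (0 ≤ d) → (∀ j, |u a j - u b j| ≤ d) → ∀ i,
    |mono (u a) (y i) - mono (u b) (y i)| ≤ L * d ∧ mono (u a) (y i) ≤ L ∧
    |mono (u a) (y' i) - mono (u b) (y' i)| ≤ L * d ∧ mono (u a) (y' i) ≤ L := by
  obtain ⟨L, hL1, hL⟩ := mono_lip Mb h.hMb (Sum.elim y y')
  refine ⟨L, hL1, fun a b d hd hj i => ?_⟩
  have h1 := hL (Sum.inl i) (u a) (u b) d (fun j => (h.pos a j).le) (h.bdd a) (fun j => (h.pos b j).le) (h.bdd b) hd hj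
  have h2 := hL (Sum.inr i) (u a) (u b) d (fun j => (h.pos a j).le) (h.bdd a) (fun j => (h.pos b j).le) (h.bdd b) hd hj
  simp only [Sum.elim_inl, Sum.elim_inr] at h1 h2
  exact ⟨h1.1, h1.2, h2.1, h2.2⟩

theorem NS.bound (h : NS y y' K τ m τm Mb u) : ∃ L, 1 ≤ L ∧ ∀ a i,
    mono (u a) (y i) ≤ L ∧ mono (u a) (y' i) ≤ L := by
  obtain ⟨L, hL1, hL⟩ := h.lip
  refine ⟨L, hL1, fun a i => ?_⟩
  have := hL a a 0 le_rfl (by simp) i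
  exact ⟨this.2.1, this.2.2.2⟩

theorem NS.decay (h : NS y y' K τ m τm Mb u) : ∃ C, 1 ≤ C ∧ ∀ a b, 0 < a → a ≤ b → ∀ j,
    u a j * Real.exp (-C * (b - a)) ≤ u b j := by
  obtain ⟨L, hL1, hL⟩ := mono_le_coord Mb h.hMb y
  obtain ⟨C, hC1, hC⟩ : ∃ C, 1 ≤ C ∧ ∀ j, (∑ i, K i * (L * (y i j : ℝ))) / m j ≤ C :=
    exists_unif (fun _ _ _ h1 h2 => h2.trans h1) (fun j => ⟨_, le_rfl⟩)
  refine ⟨C, hC1, fun a b ha hab j => ?_⟩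
  refine decay_gen (fun t => u t j) _ a b C hab ((h.cont j).continuousOn)
    (fun t ht => h.der t (ha.trans ht.1) j) (fun t ht => ?_)
  rw [le_div_iff₀ (h.hm j)]
  have h1 : ∑ i, K i * (L * (y i j : ℝ)) ≤ C * m j := by
    have := hC j
    rwa [div_le_iff₀ (h.hm j)] at this
  have h2 : -(∑ i, K i * (L * (y i j : ℝ))) * u t j ≤ ∑ i, K i * (mono (u (t - τ i)) (y i) * (y' i j : ℝ) - mono (u t) (y i) * (y i j : ℝ)) := by
    rw [← Finset.sum_neg_distrib, Finset.sum_mul]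
    apply Finset.sum_le_sum
    intro i _
    have p1 : 0 ≤ mono (u (t - τ i)) (y i) * (y' i j : ℝ) := mul_nonneg (h.mpos _ _).le (by positivity)
    have p2 : mono (u t) (y i) * (y i j : ℝ) ≤ L * u t j * (y i j : ℝ) := by
      by_cases hz : y i j = 0
      · simp [hz]
      · exact mul_le_mul_of_nonneg_right (hL i (u t) j (fun j => (h.pos t j).le) (h.bdd t) hz) (by positivity)
    have := mul_le_mul_of_nonneg_left (show -(L * u t j * (y i j : ℝ)) ≤ mono (u (t - τ i)) (y i) * (y' i j : ℝ) - mono (u t) (y i) * (y i j : ℝ) by linarith) (h.hK i).le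
    linarith
  have := h.pos t j
  nlinarith

theorem NS.inc (h : NS y y' K τ m τm Mb u) : ∃ C, 1 ≤ C ∧ ∀ a b, 0 < a → a ≤ b → ∀ lam > 0, ∀ j,
    |u b j - u a j| ≤ lam * (b - a) + C / lam * (Hf y K τ m u univ univ a - Hf y K τ m u univ univ b) := by
  obtain ⟨B, hB1, hB⟩ := h.bound
  obtain ⟨c, hc1, hc⟩ : ∃ C, 1 ≤ C ∧ ∀ p : Fin r × Fin n, (y' p.1 p.2 : ℝ) / m p.2 ≤ C :=
    exists_unif (fun _ _ _ h1 h2 => h2.trans h1) (fun j => ⟨_, le_rfl⟩)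
  set Kt := 1 + ∑ i, K i with hKt
  have hKs : 0 ≤ ∑ i, K i := Finset.sum_nonneg (fun i _ => (h.hK i).le)
  have hKt1 : 1 ≤ Kt := by linarith
  have hC1 : 1 ≤ Kt * c ^ 2 * B := by
    have : 1 ≤ c ^ 2 := by nlinarith
    have : 1 ≤ Kt * c ^ 2 := by nlinarith
    nlinarith
  refine ⟨Kt * c ^ 2 * B, hC1, fun a b ha hab lam hlam j => ?_⟩
  -- derivative bound
  have key : ∀ t > 0, |(∑ i, K i * (mono (u (t - τ i)) (y i) * (y' i j : ℝ) - mono (u t) (y i) * (y i j : ℝ))) / m j|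
      ≤ lam + (Kt * c ^ 2 * B) / lam * (∑ i, K i * h2 (mono (u (t - τ i)) (y i)) (mono (u t) (y' i))) := by
    intro t ht
    have e1 : ∑ i, K i * (mono (u (t - τ i)) (y i) * (y' i j : ℝ) - mono (u t) (y i) * (y i j : ℝ))
      = ∑ i, K i * ((mono (u (t - τ i)) (y i) - mono (u t) (y' i)) * (y' i j : ℝ)) := by
      have := h.bal (fun z => mono (u t) z * (z j : ℝ))
      simp only [mul_sub, sub_mul, Finset.sum_sub_distrib]
      rw [this]
    rw [e1, Finset.sum_div]
    refine (Finset.abs_sum_le_sum_abs _ _).trans ?_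
    have e2 : ∀ i, |K i * ((mono (u (t - τ i)) (y i) - mono (u t) (y' i)) * (y' i j : ℝ)) / m j| ≤
        K i * (lam / Kt) + (Kt * c ^ 2 * B) / lam * (K i * h2 (mono (u (t - τ i)) (y i)) (mono (u t) (y' i))) := by
      intro i
      have b1 := h2_lower (h.mpos (y i) (t - τ i)) (h.mpos (y' i) t) (hB (t - τ i) i).1 (hB t i).2
      set d := mono (u (t - τ i)) (y i) - mono (u t) (y' i)
      set Q := h2 (mono (u (t - τ i)) (y i)) (mono (u t) (y' i))
      have hcc := hc (i, j)
      simp only at hcc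
      have hmj := h.hm j
      have e3 : |K i * (d * (y' i j : ℝ)) / m j| = K i * (|d| * ((y' i j : ℝ) / m j)) := by
        rw [abs_div, abs_mul, abs_mul, abs_of_pos (h.hK i), abs_of_pos hmj, abs_of_nonneg (Nat.cast_nonneg (α := ℝ) (y' i j))]
        ring
      rw [e3]
      have e4 : |d| * ((y' i j : ℝ) / m j) ≤ |d| * c := by gcongr
      have e5 : d ^ 2 ≤ 4 * B * Q := by
        rw [div_mul_eq_mul_div, one_mul, div_le_iff₀ (by linarith)] at b1
        linarith
      have e6 : |d| * c ≤ lam / Kt + (Kt * c ^ 2) / (4 * lam) * d ^ 2 := by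
        have hs := sq_nonneg (2 * lam - Kt * c * |d|)
        have hd2 : d ^ 2 = |d| ^ 2 := (sq_abs d).symm
        rw [hd2, div_mul_eq_mul_div, div_add_div _ _ (by positivity) (by positivity), le_div_iff₀ (by positivity)]
        nlinarith
      have e7 : (Kt * c ^ 2) / (4 * lam) * d ^ 2 ≤ (Kt * c ^ 2) / (4 * lam) * (4 * B * Q) := by gcongr
      have e8 : (Kt * c ^ 2) / (4 * lam) * (4 * B * Q) = (Kt * c ^ 2 * B) / lam * Q := by field_simp
      calc K i * (|d| * ((y' i j : ℝ) / m j)) ≤ K i * (lam / Kt + (Kt * c ^ 2 * B) / lam * Q) :=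
            mul_le_mul_of_nonneg_left (by linarith) (h.hK i).le
        _ = _ := by ring
    refine (Finset.sum_le_sum (fun i _ => e2 i)).trans ?_
    rw [Finset.sum_add_distrib, ← Finset.mul_sum, ← Finset.sum_mul]
    have : (∑ i, K i) * (lam / Kt) ≤ lam := by
      rw [mul_div_assoc', div_le_iff₀ (by positivity)]
      nlinarith
    linarith
  have anti : ∀ σ : ℝ, |σ| ≤ 1 → AntitoneOn (fun t => σ * u t j - lam * t + (Kt * c ^ 2 * B) / lam * Hf y K τ m u univ univ t) (Set.Icc a b) := by
    intro σ hσ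
    have dd : ∀ t, 0 < t → HasDerivAt (fun t => σ * u t j - lam * t + (Kt * c ^ 2 * B) / lam * Hf y K τ m u univ univ t) _ t := fun t ht =>
      (((h.der t ht j).const_mul σ).sub ((hasDerivAt_id t).const_mul lam)).add ((h.V_deriv ht).const_mul _)
    apply antitoneOn_of_hasDerivWithinAt_nonpos (convex_Icc a b)
    · exact fun t ht => (dd t (ha.trans_le ht.1)).continuousAt.continuousWithinAt
    · intro t ht
      rw [interior_Icc] at ht
      exact (dd t (ha.trans ht.1)).hasDerivWithinAt
    · intro t ht
      rw [interior_Icc] at ht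
      have k1 := key t (ha.trans ht.1)
      set R := (∑ i, K i * (mono (u (t - τ i)) (y i) * (y' i j : ℝ) - mono (u t) (y i) * (y i j : ℝ))) / m j
      have k2 : σ * R ≤ |R| := by
        calc σ * R ≤ |σ * R| := le_abs_self _
          _ = |σ| * |R| := abs_mul _ _
          _ ≤ 1 * |R| := by gcongr
          _ = _ := one_mul _
      linarith
  have a1 := anti 1 (by simp) (Set.left_mem_Icc.2 hab) (Set.right_mem_Icc.2 hab) hab
  have a2 := anti (-1) (by simp) (Set.left_mem_Icc.2 hab) (Set.right_mem_Icc.2 hab) hab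
  simp only at a1 a2
  rw [abs_le]
  constructor <;> linarith

theorem NS.core (h : NS y y' K τ m τm Mb u) : ∃ C, 1 ≤ C ∧ ∀ t, τm + 1 < t → ∀ q,
    q = Hf y K τ m u univ univ (t - (τm + 1)) - Hf y K τ m u univ univ t → 0 ≤ q ∧
    (∀ s ∈ Set.Icc (t - (τm + 1)) t, ∀ j, |u s j - u t j| ≤ C * √q) ∧
    (∀ i, |mono (u t) (y i) - mono (u t) (y' i)| ≤ C * √q) := by
  obtain ⟨C, hC1, hC⟩ := h.inc
  obtain ⟨L, hL1, hL⟩ := h.lip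
  obtain ⟨B, hB1, hB⟩ := h.bound
  obtain ⟨c, hc1, hc⟩ : ∃ c, 1 ≤ c ∧ ∀ i, 4 * B / K i ≤ c :=
    exists_unif (fun _ _ _ h1 h2 => h2.trans h1) (fun j => ⟨_, le_rfl⟩)
  have hτm0 := h.hτm0
  set C1 := (τm + 1) + C with hC1d
  have hC11 : 1 ≤ C1 := by linarith
  refine ⟨C1 + 2 * L * C1 + c, by nlinarith, fun t ht q hq => ?_⟩
  have hV := h.V_anti
  have hq0 : 0 ≤ q := by
    have := hV (show t - (τm + 1) ∈ Set.Ioi 0 by simp; linarith) (show t ∈ Set.Ioi 0 by simp; linarith) (by linarith)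
    linarith
  have sq0 := Real.sqrt_nonneg q
  have A1 : ∀ s ∈ Set.Icc (t - (τm + 1)) t, ∀ j, |u s j - u t j| ≤ C1 * √q := by
    intro s hs j
    apply sqrt_opt hq0 (by linarith)
    intro lam hlam
    have k := hC s t (by linarith [hs.1]) hs.2 lam hlam j
    rw [abs_sub_comm] at k
    refine k.trans ?_
    have k2 := hV (show t - (τm + 1) ∈ Set.Ioi 0 by simp; linarith) (show s ∈ Set.Ioi 0 by simp; linarith [hs.1]) hs.1
    have : C / lam * (Hf y K τ m u univ univ s - Hf y K τ m u univ univ t) ≤ C / lam * q := by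
      gcongr; rw [hq]; linarith
    have : lam * (t - s) ≤ lam * (τm + 1) := by gcongr; linarith [hs.1]
    linarith
  refine ⟨hq0, fun s hs j => (A1 s hs j).trans ?_, fun i => ?_⟩
  · gcongr
    nlinarith
  obtain ⟨s, hs, hsd⟩ := exists_hasDerivAt_eq_slope (Hf y K τ m u univ univ) _ (show t - 1 < t by linarith)
    (fun s hs => (h.V_deriv (by linarith [hs.1])).continuousAt.continuousWithinAt)
    (fun s hs => h.V_deriv (by linarith [hs.1]))
  have hQ : ∑ i, K i * h2 (mono (u (s - τ i)) (y i)) (mono (u s) (y' i)) ≤ q := by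
    have k2 := hV (show t - (τm + 1) ∈ Set.Ioi 0 by simp; linarith) (show t - 1 ∈ Set.Ioi 0 by simp; linarith) (by linarith)
    have e : t - (t - 1) = 1 := by ring
    rw [e, div_one] at hsd
    linarith
  have hQi : K i * h2 (mono (u (s - τ i)) (y i)) (mono (u s) (y' i)) ≤ q :=
    le_trans (Finset.single_le_sum (f := fun i => K i * h2 (mono (u (s - τ i)) (y i)) (mono (u s) (y' i)))
      (fun i _ => mul_nonneg (h.hK i).le (h2_nonneg (h.mpos _ _) (h.mpos _ _))) (Finset.mem_univ i)) hQ
  have b1 := h2_lower (h.mpos (y i) (s - τ i)) (h.mpos (y' i) s) (hB (s - τ i) i).1 (hB s i).2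
  have hd2 : (mono (u (s - τ i)) (y i) - mono (u s) (y' i)) ^ 2 ≤ c * q := by
    have hKi := h.hK i
    have hci := hc i
    rw [div_le_iff₀ hKi] at hci
    rw [div_mul_eq_mul_div, one_mul, div_le_iff₀ (by linarith)] at b1
    set d2 := (mono (u (s - τ i)) (y i) - mono (u s) (y' i)) ^ 2
    set Q := h2 (mono (u (s - τ i)) (y i)) (mono (u s) (y' i))
    have : K i * d2 ≤ K i * (c * q) := by
      calc K i * d2 ≤ K i * (Q * (4 * B)) := by gcongr
        _ = (K i * Q) * (4 * B) := by ring
        _ ≤ q * (4 * B) := by gcongr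
        _ ≤ q * (c * K i) := by gcongr
        _ = _ := by ring
    exact le_of_mul_le_mul_left this hKi
  have hd : |mono (u (s - τ i)) (y i) - mono (u s) (y' i)| ≤ c * √q := by
    apply abs_le_of_sq_le_sq _ (by positivity)
    rw [mul_pow, Real.sq_sqrt hq0]
    refine hd2.trans ?_
    gcongr
    nlinarith
  have i1 : s - τ i ∈ Set.Icc (t - (τm + 1)) t := ⟨by linarith [hs.1, h.hτm i], by linarith [hs.2, h.hτ i]⟩
  have i2 : s ∈ Set.Icc (t - (τm + 1)) t := ⟨by linarith [hs.1], hs.2.le⟩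
  have l1 := (hL _ _ _ (by positivity) (A1 _ i1) i).1
  have l2 := (hL _ _ _ (by positivity) (A1 _ i2) i).2.2.1
  calc |mono (u t) (y i) - mono (u t) (y' i)| = |-(mono (u (s - τ i)) (y i) - mono (u t) (y i)) + (mono (u (s - τ i)) (y i) - mono (u s) (y' i)) + (mono (u s) (y' i) - mono (u t) (y' i))| := by ring_nf
    _ ≤ |-(mono (u (s - τ i)) (y i) - mono (u t) (y i))| + |mono (u (s - τ i)) (y i) - mono (u s) (y' i)| + |mono (u s) (y' i) - mono (u t) (y' i)| := abs_add_three _ _ _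
    _ ≤ L * (C1 * √q) + c * √q + L * (C1 * √q) := by rw [abs_neg]; gcongr
    _ ≤ _ := by nlinarith [mul_nonneg (show 0 ≤ C1 by linarith) sq0]

theorem NS.q_tendsto (h : NS y y' K τ m τm Mb u) :
    Tendsto (fun t => √(Hf y K τ m u univ univ (t - (τm + 1)) - Hf y K τ m u univ univ t)) atTop (nhds 0) := by
  have hanti : Antitone (fun t => Hf y K τ m u univ univ (max t 1)) := by
    intro a b hab
    exact h.V_anti (by simp) (by simp) (max_le_max_right 1 hab)
  have hl := tendsto_atTop_ciInf hanti ⟨0, by rintro _ ⟨t, rfl⟩; exact h.Hf_nonneg _ _ _⟩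
  have hl2 : Tendsto (Hf y K τ m u univ univ) atTop (nhds (⨅ t, Hf y K τ m u univ univ (max t 1))) := by
    refine hl.congr' ?_
    filter_upwards [eventually_ge_atTop 1] with t ht
    rw [max_eq_left ht]
  have h3 : Tendsto (fun t : ℝ => t - (τm + 1)) atTop atTop := tendsto_atTop_add_const_right _ _ tendsto_id
  have h4 := ((hl2.comp h3).sub hl2).sqrt
  simpa using h4

end NSsec2

noncomputable def Phi (y : Fin r → Fin n → ℕ) (K τ : Fin r → ℝ) (m : Fin n → ℝ)
    (u : ℝ → Fin n → ℝ) (W : Finset (Fin n)) (A : Finset (Fin r)) (f : ℝ → ℝ) (t : ℝ) : ℝ :=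
  ∑ j ∈ W, m j * f (u t j) + ∑ i ∈ A, K i * ∫ s in (t - τ i)..t, f (mono (u s) (y i))

def HasExt (y y' : Fin r → Fin n → ℕ) (W : Finset (Fin n)) (A : Finset (Fin r)) : Prop :=
  ∃ C : ℝ, 1 ≤ C ∧ ∀ ξ : Fin n → ℝ, ∀ e R : ℝ, 0 ≤ e → 0 ≤ R → (∀ j, |ξ j| ≤ R) →
    (∀ i ∉ A, |∑ j, ξ j * ((y' i j : ℝ) - (y i j : ℝ))| ≤ e) →
    ∃ η : Fin n → ℝ, (∀ i, ∑ j, η j * ((y' i j : ℝ) - (y i j : ℝ)) = 0) ∧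
      (∀ j ∉ W, |η j - ξ j| ≤ C * e) ∧ ∀ j, |η j| ≤ C * R

theorem lin_bdd {a b : ℕ} (f : (Fin a → ℝ) →ₗ[ℝ] (Fin b → ℝ)) :
    ∃ C : ℝ, 1 ≤ C ∧ ∀ x R, 0 ≤ R → (∀ j, |x j| ≤ R) → ∀ j, |f x j| ≤ C * R := by
  refine ⟨1 + ‖LinearMap.toContinuousLinearMap f‖, by linarith [norm_nonneg (LinearMap.toContinuousLinearMap f)], fun x R hR hx j => ?_⟩
  have h1 := (LinearMap.toContinuousLinearMap f).le_opNorm x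
  have h2 : ‖x‖ ≤ R := (pi_norm_le_iff_of_nonneg hR).2 hx
  have h3 : |f x j| ≤ ‖f x‖ := norm_le_pi_norm (f x) j
  have h4 : ‖f x‖ ≤ ‖LinearMap.toContinuousLinearMap f‖ * ‖x‖ := h1
  have := norm_nonneg (LinearMap.toContinuousLinearMap f)
  nlinarith

theorem lin_geninv {a b : ℕ} (f : (Fin a → ℝ) →ₗ[ℝ] (Fin b → ℝ)) :
    ∃ g : (Fin b → ℝ) →ₗ[ℝ] (Fin a → ℝ), ∀ x, f (g (f x)) = f x := by
  obtain ⟨g0, hg0⟩ := f.rangeRestrict.exists_rightInverse_of_surjective f.range_rangeRestrict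
  obtain ⟨g, hg⟩ := LinearMap.exists_extend g0
  refine ⟨g, fun x => ?_⟩
  have h1 : g (f x) = g0 (f.rangeRestrict x) := by
    rw [← hg]; rfl
  rw [h1]
  have h2 := LinearMap.congr_fun hg0 (f.rangeRestrict x)
  have h3 := congrArg Subtype.val h2
  simpa using h3

theorem hasExt_of (y y' : Fin r → Fin n → ℕ) (W : Finset (Fin n)) (A : Finset (Fin r))
    (hAW : ∀ i ∉ A, ∀ j ∈ W, y i j = 0 ∧ y' i j = 0)
    (hinj : ∀ v ∈ stoichOn y y' A, (∀ j ∈ W, v j = 0) → v = 0) : HasExt y y' W A := by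
  classical
  let G : (Fin n → ℝ) →ₗ[ℝ] (Fin r → ℝ) := LinearMap.pi (fun i => if i ∈ A then 0 else
    ∑ j, ((y' i j : ℝ) - (y i j : ℝ)) • LinearMap.proj j)
  have hG : ∀ ξ, ∀ i ∉ A, G ξ i = ∑ j, ξ j * ((y' i j : ℝ) - (y i j : ℝ)) := by
    intro ξ i hi
    simp [G, hi, LinearMap.sum_apply, mul_comm]
  have hG' : ∀ ξ, ∀ i ∈ A, G ξ i = 0 := by
    intro ξ i hi
    simp [G, hi]
  obtain ⟨H, hH⟩ := lin_geninv G
  let f : stoichOn y y' A →ₗ[ℝ] (Fin n → ℝ) :=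
    (LinearMap.pi (fun j => if j ∈ W then LinearMap.proj j else 0)) ∘ₗ (stoichOn y y' A).subtype
  have hf : ∀ v : stoichOn y y' A, ∀ j, f v j = if j ∈ W then (v : Fin n → ℝ) j else 0 := by
    intro v j
    by_cases hj : j ∈ W <;> simp [f, hj]
  have hker : LinearMap.ker f = ⊥ := by
    rw [LinearMap.ker_eq_bot']
    intro v hv
    apply Subtype.ext
    apply hinj v v.2
    intro j hj
    have := congrFun hv j
    rw [hf, if_pos hj] at this
    simpa using this
  obtain ⟨g, hg⟩ := f.exists_leftInverse_of_injective hker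
  let E : (Fin n → ℝ) →ₗ[ℝ] (Fin n → ℝ) := LinearMap.pi (fun j => if j ∈ W then
    -∑ j' ∈ Wᶜ, ((g (Pi.single j 1) : stoichOn y y' A) : Fin n → ℝ) j' • LinearMap.proj j' else LinearMap.proj j)
  have hE1 : ∀ ξ, ∀ j ∉ W, E ξ j = ξ j := by
    intro ξ j hj
    simp [E, hj]
  have hE2 : ∀ ξ, ∀ j ∈ W, E ξ j = -∑ j' ∈ Wᶜ, ((g (Pi.single j 1) : stoichOn y y' A) : Fin n → ℝ) j' * ξ j' := by
    intro ξ j hj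
    simp [E, hj, LinearMap.sum_apply]
  have hE3 : ∀ ξ, ∀ v ∈ stoichOn y y' A, ∑ j, E ξ j * v j = 0 := by
    intro ξ v hv
    rw [← Finset.sum_add_sum_compl W]
    have e1 : ∀ j', v j' = ∑ w ∈ W, v w * ((g (Pi.single w 1) : stoichOn y y' A) : Fin n → ℝ) j' := by
      intro j'
      have h1 : g (f ⟨v, hv⟩) = ⟨v, hv⟩ := LinearMap.congr_fun hg ⟨v, hv⟩
      have h2 : f ⟨v, hv⟩ = ∑ w ∈ W, v w • Pi.single w (1:ℝ) := by
        ext j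
        rw [hf]
        simp [Finset.sum_apply, Pi.single_apply]
      rw [h2] at h1
      have h3 := congrFun (congrArg Subtype.val h1) j'
      simp only [map_sum, map_smul] at h3
      rw [← h3]
      simp [Finset.sum_apply]
    have e2 : ∑ j ∈ Wᶜ, E ξ j * v j = ∑ j ∈ Wᶜ, ξ j * ∑ w ∈ W, v w * ((g (Pi.single w 1) : stoichOn y y' A) : Fin n → ℝ) j := by
      apply Finset.sum_congr rfl
      intro j hj
      rw [hE1 ξ j (by simpa using hj), ← e1]
    have e3 : ∑ j ∈ W, E ξ j * v j = ∑ j ∈ W, -(∑ j' ∈ Wᶜ, ((g (Pi.single j 1) : stoichOn y y' A) : Fin n → ℝ) j' * ξ j') * v j := by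
      apply Finset.sum_congr rfl
      intro j hj
      rw [hE2 ξ j hj]
    rw [e2, e3]
    simp only [neg_mul, Finset.sum_neg_distrib, Finset.mul_sum, Finset.sum_mul]
    rw [Finset.sum_comm, neg_add_eq_zero]
    apply Finset.sum_congr rfl
    intro j _
    apply Finset.sum_congr rfl
    intro w _
    ring
  obtain ⟨C1, hC1, hb1⟩ := lin_bdd H
  obtain ⟨C2, hC2, hb2⟩ := lin_bdd (E ∘ₗ (LinearMap.id - H ∘ₗ G))
  refine ⟨C1 + C2, by linarith, fun ξ e R he hR hξ hi => ⟨E (ξ - H (G ξ)), ?_, ?_, ?_⟩⟩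
  · intro i
    by_cases hiA : i ∈ A
    · exact hE3 _ _ (Submodule.subset_span ⟨i, hiA, rfl⟩)
    · have e1 : ∑ j, E (ξ - H (G ξ)) j * ((y' i j : ℝ) - (y i j : ℝ)) = G (ξ - H (G ξ)) i := by
        rw [hG _ i hiA]
        apply Finset.sum_congr rfl
        intro j _
        by_cases hj : j ∈ W
        · simp [hAW i hiA j hj]
        · rw [hE1 _ j hj]
      rw [e1, map_sub, hH, sub_self]
      rfl
  · intro j hj
    rw [hE1 _ j hj]
    have : (ξ - H (G ξ)) j - ξ j = -(H (G ξ) j) := by simp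
    rw [this, abs_neg]
    refine (hb1 (G ξ) e he ?_ j).trans (by nlinarith)
    intro i
    by_cases hiA : i ∈ A
    · rw [hG' _ i hiA]; simpa using he
    · rw [hG _ i hiA]; exact hi i hiA
  · intro j
    have := hb2 ξ R hR hξ j
    simp only [LinearMap.comp_apply, LinearMap.sub_apply, LinearMap.id_apply] at this
    nlinarith

section NSsec3
variable {y y' : Fin r → Fin n → ℕ} {K τ : Fin r → ℝ} {m : Fin n → ℝ} {τm Mb : ℝ}
    {u : ℝ → Fin n → ℝ} {W : Finset (Fin n)} {A : Finset (Fin r)}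

theorem NS.Phi_mono (h : NS y y' K τ m τm Mb u) {f g : ℝ → ℝ} (hf : Continuous f) (hg : Continuous g)
    {t : ℝ} (h1 : ∀ j ∈ W, f (u t j) ≤ g (u t j))
    (h2 : ∀ i ∈ A, ∀ s ∈ Set.Icc (t - (τm + 1)) t, f (mono (u s) (y i)) ≤ g (mono (u s) (y i))) :
    Phi y K τ m u W A f t ≤ Phi y K τ m u W A g t := by
  unfold Phi
  apply add_le_add
  · exact Finset.sum_le_sum (fun j hj => mul_le_mul_of_nonneg_left (h1 j hj) (h.hm j).le)
  · refine Finset.sum_le_sum (fun i hi => mul_le_mul_of_nonneg_left ?_ (h.hK i).le)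
    apply intervalIntegral.integral_mono_on (by linarith [h.hτ i])
      ((hf.comp (h.mcont (y i))).intervalIntegrable _ _) ((hg.comp (h.mcont (y i))).intervalIntegrable _ _)
    intro s hs
    exact h2 i hi s ⟨by linarith [hs.1, h.hτm i], hs.2⟩

theorem NS.Phi_sub (h : NS y y' K τ m τm Mb u) {f g : ℝ → ℝ} (hf : Continuous f) (hg : Continuous g) (t : ℝ) :
    Phi y K τ m u W A (fun a => f a - g a) t = Phi y K τ m u W A f t - Phi y K τ m u W A g t := by
  unfold Phi
  have : ∀ i, (∫ s in (t - τ i)..t, (f (mono (u s) (y i)) - g (mono (u s) (y i)))) =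
      (∫ s in (t - τ i)..t, f (mono (u s) (y i))) - ∫ s in (t - τ i)..t, g (mono (u s) (y i)) := fun i =>
    intervalIntegral.integral_sub ((hf.comp (h.mcont (y i))).intervalIntegrable _ _) ((hg.comp (h.mcont (y i))).intervalIntegrable _ _)
  simp only [this, mul_sub, Finset.sum_sub_distrib]
  ring

theorem Phi_smul (c : ℝ) (f : ℝ → ℝ) (t : ℝ) :
    Phi y K τ m u W A (fun a => c * f a) t = c * Phi y K τ m u W A f t := by
  unfold Phi
  simp only [intervalIntegral.integral_const_mul, mul_add, Finset.mul_sum]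
  congr 1 <;> exact Finset.sum_congr rfl (fun _ _ => by ring)

theorem Phi_const (c : ℝ) (t : ℝ) :
    Phi y K τ m u W A (fun _ => c) t = c * (∑ j ∈ W, m j + ∑ i ∈ A, K i * τ i) := by
  unfold Phi
  simp only [intervalIntegral.integral_const, mul_add, Finset.mul_sum, smul_eq_mul]
  congr 1 <;> exact Finset.sum_congr rfl (fun _ _ => by ring)

theorem Phi_split (W : Finset (Fin n)) (A : Finset (Fin r)) (f : ℝ → ℝ) (t : ℝ) :
    Phi y K τ m u univ univ f t = Phi y K τ m u W A f t + Phi y K τ m u Wᶜ Aᶜ f t := by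
  unfold Phi
  rw [← Finset.sum_add_sum_compl W, ← Finset.sum_add_sum_compl A]
  ring

/-- conserved quantity -/
theorem NS.conserve (h : NS y y' K τ m τm Mb u) (η : Fin n → ℝ)
    (hη : ∀ i, ∑ j, η j * ((y' i j : ℝ) - (y i j : ℝ)) = 0) {a b : ℝ} (ha : 0 < a) (hb : 0 < b) :
    ∑ j, η j * (m j * u a j) + ∑ i, (∑ j, η j * (y i j : ℝ)) * (K i * ∫ s in (a - τ i)..a, mono (u s) (y i))
    = ∑ j, η j * (m j * u b j) + ∑ i, (∑ j, η j * (y i j : ℝ)) * (K i * ∫ s in (b - τ i)..b, mono (u s) (y i)) := by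
  have hd : ∀ t > 0, HasDerivAt (fun a => ∑ j, η j * (m j * u a j) + ∑ i, (∑ j, η j * (y i j : ℝ)) * (K i * ∫ s in (a - τ i)..a, mono (u s) (y i))) 0 t := by
    intro t ht
    have d1 : HasDerivAt (fun a => ∑ j, η j * (m j * u a j)) _ t :=
      HasDerivAt.fun_sum (fun j _ => ((h.der t ht j).const_mul (m j)).const_mul (η j))
    have d2 : HasDerivAt (fun a => ∑ i, (∑ j, η j * (y i j : ℝ)) * (K i * ∫ s in (a - τ i)..a, mono (u s) (y i))) _ t :=
      HasDerivAt.fun_sum (fun i _ => ((hasDerivAt_win _ (h.mcont (y i)) (τ i) t).const_mul (K i)).const_mul (∑ j, η j * (y i j : ℝ)))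
    refine (d1.add d2).congr_deriv ?_
    have e1 : ∀ i, ∑ j, η j * (y' i j : ℝ) = ∑ j, η j * (y i j : ℝ) := by
      intro i
      have := hη i
      simp only [mul_sub, Finset.sum_sub_distrib] at this
      linarith
    have e2 : ∑ j, η j * (m j * ((∑ i, K i * (mono (u (t - τ i)) (y i) * (y' i j : ℝ) - mono (u t) (y i) * (y i j : ℝ))) / m j))
        = ∑ i, K i * (mono (u (t - τ i)) (y i) * (∑ j, η j * (y' i j : ℝ)) - mono (u t) (y i) * (∑ j, η j * (y i j : ℝ))) := by
      have : ∀ j, η j * (m j * ((∑ i, K i * (mono (u (t - τ i)) (y i) * (y' i j : ℝ) - mono (u t) (y i) * (y i j : ℝ))) / m j))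
        = ∑ i, K i * (mono (u (t - τ i)) (y i) * (η j * (y' i j : ℝ)) - mono (u t) (y i) * (η j * (y i j : ℝ))) := by
        intro j
        rw [mul_div_cancel₀ _ (h.hm j).ne', Finset.mul_sum]
        exact Finset.sum_congr rfl (fun i _ => by ring)
      rw [Finset.sum_congr rfl (fun j _ => this j), Finset.sum_comm]
      apply Finset.sum_congr rfl
      intro i _
      rw [← Finset.mul_sum, Finset.sum_sub_distrib, Finset.mul_sum, Finset.mul_sum]
    rw [e2, ← Finset.sum_add_distrib]
    apply Finset.sum_eq_zero
    intro i _
    rw [e1]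
    ring
  have hconst := (convex_Ioi (0:ℝ)).is_const_of_fderivWithin_eq_zero (𝕜 := ℝ) (f := fun a => ∑ j, η j * (m j * u a j) + ∑ i, (∑ j, η j * (y i j : ℝ)) * (K i * ∫ s in (a - τ i)..a, mono (u s) (y i)))
    (fun t ht => (hd t ht).differentiableAt.differentiableWithinAt)
    (fun t ht => by
      have := (hd t ht).hasFDerivAt.hasFDerivWithinAt (s := Set.Ioi 0)
      rw [this.fderivWithin (uniqueDiffOn_Ioi 0 t ht)]
      ext; simp)
    (x := a) (y := b) ha hb
  exact hconst

end NSsec3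

noncomputable def qf (y : Fin r → Fin n → ℕ) (K τ : Fin r → ℝ) (m : Fin n → ℝ) (τm : ℝ)
    (u : ℝ → Fin n → ℝ) (t : ℝ) : ℝ :=
  Hf y K τ m u univ univ (t - (τm + 1)) - Hf y K τ m u univ univ t

/-- the context of the local analysis -/
structure Ctx (y y' : Fin r → Fin n → ℕ) (K τ : Fin r → ℝ) (m : Fin n → ℝ) (τm Mb : ℝ)
    (u : ℝ → Fin n → ℝ) (W : Finset (Fin n)) (A : Finset (Fin r)) (tN : ℕ → ℝ) : Prop where
  ns : NS y y' K τ m τm Mb u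
  hA : ∀ i, i ∈ A ↔ ∃ j ∈ W, y i j ≠ 0
  hA' : ∀ i, i ∈ A ↔ ∃ j ∈ W, y' i j ≠ 0
  hW : W.Nonempty
  ext : HasExt y y' W A
  htN : Tendsto tN atTop atTop
  lim : ∀ j, Tendsto (fun N => u (tN N) j) atTop (nhds (if j ∈ W then 0 else 1))

section Csec
variable {y y' : Fin r → Fin n → ℕ} {K τ : Fin r → ℝ} {m : Fin n → ℝ} {τm Mb : ℝ}
    {u : ℝ → Fin n → ℝ} {W : Finset (Fin n)} {A : Finset (Fin r)} {tN : ℕ → ℝ}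

theorem Ctx.hAW (c : Ctx y y' K τ m τm Mb u W A tN) : ∀ i ∉ A, ∀ j ∈ W, y i j = 0 ∧ y' i j = 0 := by
  intro i hi j hj
  constructor
  · by_contra h; exact hi ((c.hA i).2 ⟨j, hj, h⟩)
  · by_contra h; exact hi ((c.hA' i).2 ⟨j, hj, h⟩)

theorem NS.core2 (h : NS y y' K τ m τm Mb u) : ∃ C, 1 ≤ C ∧ ∀ t, τm + 1 < t →
    0 ≤ qf y K τ m τm u t ∧
    (∀ s ∈ Set.Icc (t - (τm + 1)) t, ∀ j, |u s j - u t j| ≤ C * √(qf y K τ m τm u t)) ∧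
    (∀ s ∈ Set.Icc (t - (τm + 1)) t, ∀ i, |mono (u s) (y i) - mono (u t) (y i)| ≤ C * √(qf y K τ m τm u t)) ∧
    (∀ i, |mono (u t) (y i) - mono (u t) (y' i)| ≤ C * √(qf y K τ m τm u t)) ∧
    (∀ i, |(∫ s in (t - τ i)..t, mono (u s) (y i)) - τ i * mono (u t) (y i)| ≤ C * √(qf y K τ m τm u t)) := by
  obtain ⟨C, hC1, hC⟩ := h.core
  obtain ⟨L, hL1, hL⟩ := h.lip
  have hτm0 := h.hτm0
  have hLC : C ≤ L * C := by nlinarith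
  have hb : L * C ≤ (τm + 1) * (L * C) := by nlinarith [mul_nonneg hτm0 (show 0 ≤ L * C by nlinarith)]
  refine ⟨(τm + 1) * (L * C), by linarith, fun t ht => ?_⟩
  obtain ⟨h1, h2, h3⟩ := hC t ht (qf y K τ m τm u t) rfl
  set e := √(qf y K τ m τm u t)
  have he : 0 ≤ e := Real.sqrt_nonneg _
  have h4 : ∀ s ∈ Set.Icc (t - (τm + 1)) t, ∀ i, |mono (u s) (y i) - mono (u t) (y i)| ≤ L * C * e := by
    intro s hs i
    have := (hL s t (C * e) (by positivity) (h2 s hs) i).1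
    linarith
  refine ⟨h1, fun s hs j => (h2 s hs j).trans (by gcongr; linarith), fun s hs i => (h4 s hs i).trans (by gcongr),
    fun i => (h3 i).trans (by gcongr; linarith), fun i => ?_⟩
  have e1 : (∫ s in (t - τ i)..t, mono (u s) (y i)) - τ i * mono (u t) (y i) =
      ∫ s in (t - τ i)..t, (mono (u s) (y i) - mono (u t) (y i)) := by
    rw [intervalIntegral.integral_sub ((h.mcont (y i)).intervalIntegrable _ _) (continuous_const.intervalIntegrable _ _)]
    simp
  rw [e1]
  have hτi := h.hτ i
  have := intervalIntegral.norm_integral_le_of_norm_le_const (a := t - τ i) (b := t) (C := L * C * e)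
    (f := fun s => mono (u s) (y i) - mono (u t) (y i)) (by
      intro s hs
      rw [Set.uIoc_of_le (by linarith)] at hs
      exact h4 s ⟨by linarith [hs.1, h.hτm i], hs.2⟩ i)
  rw [Real.norm_eq_abs] at this
  refine this.trans ?_
  have e2 : |t - (t - τ i)| = τ i := by rw [sub_sub_cancel, abs_of_nonneg hτi]
  rw [e2]
  have : 0 ≤ L * C * e := by positivity
  have := h.hτm i
  nlinarith

theorem Ctx.conserve_lim (c : Ctx y y' K τ m τm Mb u W A tN) (η : Fin n → ℝ)
    (hη : ∀ i, ∑ j, η j * ((y' i j : ℝ) - (y i j : ℝ)) = 0) {t : ℝ} (ht : 0 < t) :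
    ∑ j, η j * (m j * u t j) + ∑ i, (∑ j, η j * (y i j : ℝ)) * (K i * ∫ s in (t - τ i)..t, mono (u s) (y i))
    = ∑ j ∈ Wᶜ, η j * m j + ∑ i ∈ Aᶜ, (∑ j, η j * (y i j : ℝ)) * (K i * τ i) := by
  have h := c.ns
  obtain ⟨C, hC1, hC⟩ := h.core2
  have hmon : ∀ i, Tendsto (fun N => mono (u (tN N)) (y i)) atTop (nhds (if i ∈ A then 0 else 1)) := by
    intro i
    have h1 : Tendsto (fun N => mono (u (tN N)) (y i)) atTop (nhds (∏ j, (if j ∈ W then (0:ℝ) else 1) ^ y i j)) :=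
      tendsto_finsetProd _ (fun j _ => (c.lim j).pow _)
    have h2 : ∏ j, (if j ∈ W then (0:ℝ) else 1) ^ y i j = if i ∈ A then 0 else 1 := by
      by_cases hi : i ∈ A
      · rw [if_pos hi]
        obtain ⟨j, hj, hjy⟩ := (c.hA i).1 hi
        exact Finset.prod_eq_zero (Finset.mem_univ j) (by simp [hj, hjy])
      · rw [if_neg hi]
        apply Finset.prod_eq_one
        intro j _
        by_cases hj : j ∈ W
        · simp [(c.hAW i hi j hj).1]
        · simp [hj]
    rwa [h2] at h1
  have hq : Tendsto (fun N => C * √(qf y K τ m τm u (tN N))) atTop (nhds 0) := by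
    have := (h.q_tendsto.comp c.htN).const_mul C
    simpa [qf, Function.comp_def] using this
  have hint : ∀ i, Tendsto (fun N => ∫ s in (tN N - τ i)..(tN N), mono (u s) (y i)) atTop (nhds (τ i * (if i ∈ A then 0 else 1))) := by
    intro i
    have h1 : Tendsto (fun N => (∫ s in (tN N - τ i)..(tN N), mono (u s) (y i)) - τ i * mono (u (tN N)) (y i)) atTop (nhds 0) := by
      apply squeeze_zero_norm' _ hq
      filter_upwards [c.htN.eventually_gt_atTop (τm + 1)] with N hN
      exact (hC _ hN).2.2.2.2 i
    have h2 := h1.add ((hmon i).const_mul (τ i))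
    simpa using h2
  have hl : Tendsto (fun N => ∑ j, η j * (m j * u (tN N) j) + ∑ i, (∑ j, η j * (y i j : ℝ)) * (K i * ∫ s in (tN N - τ i)..(tN N), mono (u s) (y i))) atTop
      (nhds (∑ j, η j * (m j * (if j ∈ W then 0 else 1)) + ∑ i, (∑ j, η j * (y i j : ℝ)) * (K i * (τ i * (if i ∈ A then 0 else 1))))) :=
    (tendsto_finsetSum _ (fun j _ => ((c.lim j).const_mul _).const_mul _)).add
      (tendsto_finsetSum _ (fun i _ => ((hint i).const_mul _).const_mul _))
  have hl2 := hl.congr' (f₂ := fun _ => ∑ j, η j * (m j * u t j) + ∑ i, (∑ j, η j * (y i j : ℝ)) * (K i * ∫ s in (t - τ i)..t, mono (u s) (y i))) (by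
    filter_upwards [c.htN.eventually_gt_atTop 0] with N hN
    exact h.conserve η hη hN ht)
  rw [tendsto_nhds_unique tendsto_const_nhds hl2]
  congr 1
  · rw [← Finset.sum_add_sum_compl W]
    rw [Finset.sum_eq_zero (s := W) (fun j hj => by simp [hj]), zero_add]
    exact Finset.sum_congr rfl (fun j hj => by simp [Finset.mem_compl.1 hj])
  · rw [← Finset.sum_add_sum_compl A]
    rw [Finset.sum_eq_zero (s := A) (fun j hj => by simp [hj]), zero_add]
    exact Finset.sum_congr rfl (fun j hj => by simp [Finset.mem_compl.1 hj])

theorem log_facts {a : ℝ} (ha : |a - 1| ≤ 1 / 2) : |Real.log a| ≤ 1 ∧ 1 / 2 * (Real.log a) ^ 2 ≤ Real.log a * (a - 1)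
    ∧ |a - 1| ≤ 2 * |Real.log a| ∧ |Real.log a| ≤ 2 * |a - 1| := by
  obtain ⟨h1, h2⟩ := abs_le.1 ha
  have hpos : 0 < a := by linarith
  have l1 : Real.log a ≤ a - 1 := Real.log_le_sub_one_of_pos hpos
  have l2 := Real.log_le_sub_one_of_pos (inv_pos.2 hpos)
  rw [Real.log_inv] at l2
  have l3 : a - 1 ≤ a * Real.log a := by
    have := mul_le_mul_of_nonneg_left l2 hpos.le
    rw [mul_sub, mul_inv_cancel₀ hpos.ne'] at this
    linarith
  rcases le_total 1 a with h | h
  · have l4 : 0 ≤ Real.log a := Real.log_nonneg h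
    rw [abs_of_nonneg l4, abs_of_nonneg (by linarith : 0 ≤ a - 1)]
    refine ⟨by linarith, by nlinarith, by nlinarith, by linarith⟩
  · have l4 : Real.log a ≤ 0 := Real.log_nonpos hpos.le h
    rw [abs_of_nonpos l4, abs_of_nonpos (by linarith : a - 1 ≤ 0)]
    have l5 : -Real.log a ≤ 2 * (1 - a) := by nlinarith
    refine ⟨by linarith, by nlinarith, by linarith, by linarith⟩

theorem exp_facts {p D : ℝ} (hp : |p| ≤ D) : 0 ≤ p * (Real.exp p - 1) ∧ |Real.exp p - 1| ≤ Real.exp D * |p| := by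
  have hD : 0 ≤ D := (abs_nonneg _).trans hp
  have h1 := Real.add_one_le_exp p
  have h2 := Real.add_one_le_exp (-p)
  have h3 : Real.exp p * Real.exp (-p) = 1 := by rw [← Real.exp_add]; simp
  have h4 := Real.exp_pos p
  have h5 : Real.exp p ≤ Real.exp D := Real.exp_le_exp.2 ((le_abs_self p).trans hp)
  have h6 : 1 ≤ Real.exp D := Real.one_le_exp hD
  have h7 : Real.exp p - 1 ≤ Real.exp p * p := by nlinarith
  rcases le_total 0 p with h | h
  · rw [abs_of_nonneg h, abs_of_nonneg (by linarith)]
    exact ⟨mul_nonneg h (by linarith), by nlinarith⟩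
  · have : Real.exp p ≤ 1 := Real.exp_le_one_iff.2 h
    rw [abs_of_nonpos h, abs_of_nonpos (by linarith)]
    exact ⟨mul_nonneg_of_nonpos_of_nonpos h (by linarith), by nlinarith⟩

end Csec

theorem abs_dot_le (ζ : Fin n → ℝ) (z : Fin n → ℕ) {b D : ℝ} (hb : 0 ≤ b) (hz : ∑ j, (z j : ℝ) ≤ D)
    (h : ∀ j, z j ≠ 0 → |ζ j| ≤ b) : |∑ j, ζ j * (z j : ℝ)| ≤ D * b := by
  calc |∑ j, ζ j * (z j : ℝ)| ≤ ∑ j, |ζ j * (z j : ℝ)| := Finset.abs_sum_le_sum_abs _ _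
    _ ≤ ∑ j, b * (z j : ℝ) := by
        apply Finset.sum_le_sum
        intro j _
        rw [abs_mul, abs_of_nonneg (Nat.cast_nonneg (α := ℝ) (z j))]
        by_cases hj : z j = 0
        · simp [hj]
        · exact mul_le_mul_of_nonneg_right (h j hj) (by positivity)
    _ = b * ∑ j, (z j : ℝ) := by rw [Finset.mul_sum]
    _ ≤ b * D := by gcongr
    _ = D * b := mul_comm _ _

theorem mul_lower {a b x y : ℝ} (ha : |a| ≤ x) (hb : |b| ≤ y) : -(x * y) ≤ a * b := by
  have h1 : |a * b| ≤ x * y := by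
    rw [abs_mul]
    exact mul_le_mul ha hb (abs_nonneg _) ((abs_nonneg _).trans ha)
  exact (abs_le.1 h1).1

section Csec2
variable {y y' : Fin r → Fin n → ℕ} {K τ : Fin r → ℝ} {m : Fin n → ℝ} {τm Mb : ℝ}
    {u : ℝ → Fin n → ℝ} {W : Finset (Fin n)} {A : Finset (Fin r)} {tN : ℕ → ℝ}

set_option maxHeartbeats 2000000 in
theorem Ctx.S1 (c : Ctx y y' K τ m τm Mb u W A tN) : ∃ C, 1 ≤ C ∧ ∀ t, τm + 1 < t →
    (∀ j ∉ W, |u t j - 1| ≤ 1 / 2) → ∀ e X, e = √(qf y K τ m τm u t) → X = Phi y K τ m u W A (fun a => a) t →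
    (∀ j ∉ W, |u t j - 1| ≤ C * (e + X)) ∧
    (∀ i ∉ A, ∀ s ∈ Set.Icc (t - (τm + 1)) t, |mono (u s) (y i) - 1| ≤ C * (e + X)) := by
  have h := c.ns
  have hAW := c.hAW
  obtain ⟨C0, hC01, hC0⟩ := h.core2
  obtain ⟨Ce, hCe1, hCe⟩ := c.ext
  obtain ⟨D, hD1, hD⟩ : ∃ D, 1 ≤ D ∧ ∀ i, ∑ j, (y i j : ℝ) ≤ D ∧ ∑ j, (y' i j : ℝ) ≤ D :=
    exists_unif (fun _ _ _ h1 h2 => ⟨h2.1.trans h1, h2.2.trans h1⟩)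
      (fun i => ⟨max (∑ j, (y i j : ℝ)) (∑ j, (y' i j : ℝ)), le_max_left _ _, le_max_right _ _⟩)
  obtain ⟨cm, hcm1, hcm⟩ : ∃ D, 1 ≤ D ∧ ∀ j, 1 / m j ≤ D :=
    exists_unif (fun _ _ _ h1 h2 => h2.trans h1) (fun j => ⟨_, le_rfl⟩)
  set ED := Real.exp D with hED
  have hED1 : 1 ≤ ED := Real.one_le_exp (by linarith)
  set C2 := ED * C0 with hC2
  set C3 := Ce * C2 with hC3
  set Mt := ∑ j, m j with hMt
  set Kt := ∑ i, K i with hKt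
  have hMt0 : 0 ≤ Mt := Finset.sum_nonneg (fun j _ => (h.hm j).le)
  have hKt0 : 0 ≤ Kt := Finset.sum_nonneg (fun j _ => (h.hK j).le)
  have hτm0 := h.hτm0
  set C5 := τm * ((D * C3) * (ED * D)) + D * Ce * C0 with hC5
  have hC5p : 0 ≤ C5 := by positivity
  set C6 := 2 * Mt * C3 + Kt * C5 + D * Ce with hC6
  have hC6p : 0 ≤ C6 := by positivity
  set C8 := 2 * cm * C6 with hC8
  have hC8p : 0 ≤ C8 := by positivity
  refine ⟨1 + 2 * C8 + C0 + ED * D * C8, by nlinarith [mul_nonneg (mul_nonneg (zero_le_one.trans hED1) (zero_le_one.trans hD1)) hC8p], fun t ht hnear e X he hX => ?_⟩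
  obtain ⟨hq0, q1, q2, q3, q4⟩ := hC0 t ht
  rw [← he] at q1 q2 q3 q4
  have he0 : 0 ≤ e := he ▸ Real.sqrt_nonneg _
  have ht0 : 0 < t := by linarith
  set I : Fin r → ℝ := fun i => ∫ s in (t - τ i)..t, mono (u s) (y i) with hI
  have hI0 : ∀ i, 0 ≤ I i := fun i =>
    intervalIntegral.integral_nonneg (by linarith [h.hτ i]) (fun s _ => (h.mpos _ s).le)
  have hXe : X = ∑ j ∈ W, m j * u t j + ∑ i ∈ A, K i * I i := hX
  have hX0 : 0 ≤ X := by
    rw [hXe]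
    exact add_nonneg (Finset.sum_nonneg (fun j _ => mul_nonneg (h.hm j).le (h.pos t j).le))
      (Finset.sum_nonneg (fun i _ => mul_nonneg (h.hK i).le (hI0 i)))
  set ξ : Fin n → ℝ := fun j => if j ∈ W then 0 else Real.log (u t j) with hξ
  have ξW : ∀ j ∈ W, ξ j = 0 := fun j hj => by simp [hξ, hj]
  have ξC : ∀ j ∉ W, ξ j = Real.log (u t j) := fun j hj => by simp [hξ, hj]
  have ξ1 : ∀ j, |ξ j| ≤ 1 := by
    intro j
    by_cases hj : j ∈ W
    · rw [ξW j hj]; simp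
    · rw [ξC j hj]; exact (log_facts (hnear j hj)).1
  set S := ∑ j, ξ j ^ 2 with hS
  have hS0 : 0 ≤ S := Finset.sum_nonneg (fun j _ => sq_nonneg _)
  set R := √S with hR
  have hR0 : 0 ≤ R := Real.sqrt_nonneg _
  have hRS : R ^ 2 = S := Real.sq_sqrt hS0
  have ξR : ∀ j, |ξ j| ≤ R := by
    intro j
    apply Real.abs_le_sqrt
    exact Finset.single_le_sum (f := fun j => ξ j ^ 2) (fun j _ => sq_nonneg _) (Finset.mem_univ j)
  have logM : ∀ i ∉ A, Real.log (mono (u t) (y i)) = ∑ j, ξ j * (y i j : ℝ) := by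
    intro i hi
    rw [mono_log _ _ (h.pos t)]
    apply Finset.sum_congr rfl
    intro j _
    by_cases hj : j ∈ W
    · simp [(hAW i hi j hj).1]
    · rw [ξC j hj]; ring
  have logN : ∀ i ∉ A, Real.log (mono (u t) (y' i)) = ∑ j, ξ j * (y' i j : ℝ) := by
    intro i hi
    rw [mono_log _ _ (h.pos t)]
    apply Finset.sum_congr rfl
    intro j _
    by_cases hj : j ∈ W
    · simp [(hAW i hi j hj).2]
    · rw [ξC j hj]; ring
  have inv_bd : ∀ a : ℝ, 0 < a → |Real.log a| ≤ D → 1 / a ≤ ED := by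
    intro a ha hl
    rw [hED, one_div, ← Real.exp_log (inv_pos.2 ha), Real.log_inv]
    exact Real.exp_le_exp.2 ((neg_le_abs _).trans hl)
  have hlogdiff : ∀ i ∉ A, |∑ j, ξ j * ((y' i j : ℝ) - (y i j : ℝ))| ≤ C2 * e := by
    intro i hi
    have e1 : ∑ j, ξ j * ((y' i j : ℝ) - (y i j : ℝ)) = Real.log (mono (u t) (y' i)) - Real.log (mono (u t) (y i)) := by
      rw [logM i hi, logN i hi, ← Finset.sum_sub_distrib]
      exact Finset.sum_congr rfl (fun j _ => by ring)
    rw [e1]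
    have k1 : |Real.log (mono (u t) (y i))| ≤ D := by
      rw [logM i hi]
      have := abs_dot_le ξ (y i) zero_le_one (hD i).1 (fun j _ => ξ1 j)
      linarith
    have k2 : |Real.log (mono (u t) (y' i))| ≤ D := by
      rw [logN i hi]
      have := abs_dot_le ξ (y' i) zero_le_one (hD i).2 (fun j _ => ξ1 j)
      linarith
    have pM := h.mpos (y i) t
    have pN := h.mpos (y' i) t
    have b1 := inv_bd _ pM k1
    have b2 := inv_bd _ pN k2
    have q := q3 i
    set M := mono (u t) (y i)
    set N := mono (u t) (y' i)
    have g : ∀ a b : ℝ, 0 < a → 0 < b → 1 / b ≤ ED → |a - b| ≤ C0 * e → Real.log a - Real.log b ≤ C2 * e := by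
      intro a b ha hb hbb hab
      rw [← Real.log_div ha.ne' hb.ne']
      have := Real.log_le_sub_one_of_pos (div_pos ha hb)
      calc Real.log (a / b) ≤ a / b - 1 := this
        _ = (1 / b) * (a - b) := by field_simp
        _ ≤ (1 / b) * (C0 * e) := by gcongr; exact (le_abs_self _).trans hab
        _ ≤ ED * (C0 * e) := by gcongr
        _ = _ := by rw [hC2]; ring
    have g1 := g M N pM pN b2 q
    have g2 := g N M pN pM b1 (by rw [abs_sub_comm]; exact q)
    rw [abs_le]
    constructor <;> linarith
  obtain ⟨η, hη0, hη1, hη2⟩ := hCe ξ (C2 * e) R (by positivity) hR0 ξR hlogdiff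
  have hη1' : ∀ j ∉ W, |η j - ξ j| ≤ C3 * e := fun j hj => (hη1 j hj).trans (by rw [hC3]; linarith)
  have hcons := c.conserve_lim η hη0 ht0
  have id0 : ∑ j ∈ Wᶜ, η j * m j * (u t j - 1) + ∑ i ∈ Aᶜ, K i * ((∑ j, η j * (y i j : ℝ)) * (I i - τ i))
      + (∑ j ∈ W, η j * (m j * u t j) + ∑ i ∈ A, (∑ j, η j * (y i j : ℝ)) * (K i * I i)) = 0 := by
    rw [← Finset.sum_add_sum_compl W (fun j => η j * (m j * u t j)), ← Finset.sum_add_sum_compl A (fun i => (∑ j, η j * (y i j : ℝ)) * (K i * ∫ s in (t - τ i)..t, mono (u s) (y i)))] at hcons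
    have r1 : ∑ j ∈ Wᶜ, η j * m j * (u t j - 1) = ∑ j ∈ Wᶜ, η j * (m j * u t j) - ∑ j ∈ Wᶜ, η j * m j := by
      rw [← Finset.sum_sub_distrib]
      exact Finset.sum_congr rfl (fun j _ => by ring)
    have r2 : ∑ i ∈ Aᶜ, K i * ((∑ j, η j * (y i j : ℝ)) * (I i - τ i)) = ∑ i ∈ Aᶜ, (∑ j, η j * (y i j : ℝ)) * (K i * I i) - ∑ i ∈ Aᶜ, (∑ j, η j * (y i j : ℝ)) * (K i * τ i) := by
      rw [← Finset.sum_sub_distrib]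
      exact Finset.sum_congr rfl (fun j _ => by ring)
    rw [r1, r2]
    linarith
  have T1 : S / (2 * cm) - Mt * (C3 * e * (2 * R)) ≤ ∑ j ∈ Wᶜ, η j * m j * (u t j - 1) := by
    have s1 : S = ∑ j ∈ Wᶜ, ξ j ^ 2 := by
      rw [hS, ← Finset.sum_add_sum_compl W, Finset.sum_eq_zero (s := W) (fun j hj => by simp [ξW j hj]), zero_add]
    have s2 : ∑ j ∈ Wᶜ, m j ≤ Mt := Finset.sum_le_sum_of_subset_of_nonneg (Finset.subset_univ _) (fun j _ _ => (h.hm j).le)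
    have s3 : ∑ j ∈ Wᶜ, (ξ j ^ 2 / (2 * cm) - m j * (C3 * e * (2 * R))) ≤ ∑ j ∈ Wᶜ, η j * m j * (u t j - 1) := by
      apply Finset.sum_le_sum
      intro j hj
      have hj := Finset.mem_compl.1 hj
      obtain ⟨l1, l2, l3, l4⟩ := log_facts (hnear j hj)
      rw [← ξC j hj] at l1 l2 l3 l4
      have hmj := h.hm j
      have m1 : 1 / cm ≤ m j := by
        have := hcm j
        rw [div_le_iff₀ hmj] at this
        rw [div_le_iff₀ (by linarith)]; linarith
      have a1 := mul_lower (hη1' j hj) (l3.trans (mul_le_mul_of_nonneg_left (ξR j) zero_le_two))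
      have a2 : m j * (1 / 2 * ξ j ^ 2) ≤ m j * (ξ j * (u t j - 1)) := by gcongr
      have a3 : ξ j ^ 2 / (2 * cm) ≤ m j * (1 / 2 * ξ j ^ 2) := by
        calc ξ j ^ 2 / (2 * cm) = (1 / cm) * (1 / 2 * ξ j ^ 2) := by field_simp
          _ ≤ _ := by gcongr
      have a4 := mul_le_mul_of_nonneg_left a1 hmj.le
      have a5 : η j * m j * (u t j - 1) = m j * (ξ j * (u t j - 1)) + m j * ((η j - ξ j) * (u t j - 1)) := by ring
      rw [a5]
      linarith
    rw [Finset.sum_sub_distrib, ← Finset.sum_div, ← s1, ← Finset.sum_mul] at s3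
    have : (∑ j ∈ Wᶜ, m j) * (C3 * e * (2 * R)) ≤ Mt * (C3 * e * (2 * R)) := by gcongr
    linarith
  have hM1 : ∀ i ∉ A, 0 ≤ (∑ j, ξ j * (y i j : ℝ)) * (mono (u t) (y i) - 1) ∧ |mono (u t) (y i) - 1| ≤ ED * D * R := by
    intro i hi
    have hM : mono (u t) (y i) = Real.exp (∑ j, ξ j * (y i j : ℝ)) := by
      rw [← logM i hi, Real.exp_log (h.mpos _ _)]
    have p0D : |∑ j, ξ j * (y i j : ℝ)| ≤ D := by
      have := abs_dot_le ξ (y i) zero_le_one (hD i).1 (fun j _ => ξ1 j)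
      linarith
    have p0R : |∑ j, ξ j * (y i j : ℝ)| ≤ D * R := abs_dot_le ξ (y i) hR0 (hD i).1 (fun j _ => ξR j)
    obtain ⟨x1, x2⟩ := exp_facts p0D
    rw [hM]
    refine ⟨x1, x2.trans ?_⟩
    rw [mul_assoc]
    gcongr
  have T2 : -(Kt * (C5 * e * R)) ≤ ∑ i ∈ Aᶜ, K i * ((∑ j, η j * (y i j : ℝ)) * (I i - τ i)) := by
    have s2 : ∑ i ∈ Aᶜ, K i ≤ Kt := Finset.sum_le_sum_of_subset_of_nonneg (Finset.subset_univ _) (fun j _ _ => (h.hK j).le)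
    have s3 : ∑ i ∈ Aᶜ, (-(K i * (C5 * e * R))) ≤ ∑ i ∈ Aᶜ, K i * ((∑ j, η j * (y i j : ℝ)) * (I i - τ i)) := by
      apply Finset.sum_le_sum
      intro i hi
      have hi := Finset.mem_compl.1 hi
      rw [← mul_neg]
      apply mul_le_mul_of_nonneg_left _ (h.hK i).le
      obtain ⟨x1, x2⟩ := hM1 i hi
      have y1 : |∑ j, η j * (y i j : ℝ) - ∑ j, ξ j * (y i j : ℝ)| ≤ D * (C3 * e) := by
        have e1 : ∑ j, η j * (y i j : ℝ) - ∑ j, ξ j * (y i j : ℝ) = ∑ j, (η j - ξ j) * (y i j : ℝ) := by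
          rw [← Finset.sum_sub_distrib]
          exact Finset.sum_congr rfl (fun j _ => by ring)
        rw [e1]
        apply abs_dot_le (fun j => η j - ξ j) (y i) (by positivity) (hD i).1
        intro j hj
        exact hη1' j (fun hjW => hj (hAW i hi j hjW).1)
      have y2 : |∑ j, η j * (y i j : ℝ)| ≤ D * (Ce * R) := abs_dot_le η (y i) (by positivity) (hD i).1 (fun j _ => hη2 j)
      have y3 := q4 i
      change |I i - τ i * mono (u t) (y i)| ≤ C0 * e at y3
      set p := ∑ j, η j * (y i j : ℝ)
      set p0 := ∑ j, ξ j * (y i j : ℝ)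
      set M := mono (u t) (y i)
      have z1 := mul_lower y1 x2
      have z2 := mul_lower y2 y3
      have hτi := h.hτ i
      have hτim := h.hτm i
      have z3 : -(τm * (D * (C3 * e) * (ED * D * R))) ≤ τ i * ((p - p0) * (M - 1)) := by
        have := mul_le_mul_of_nonneg_left z1 hτi
        have w : 0 ≤ D * (C3 * e) * (ED * D * R) := by positivity
        nlinarith
      have z4 := mul_nonneg hτi x1
      have z5 : p * (I i - τ i) = τ i * (p0 * (M - 1)) + τ i * ((p - p0) * (M - 1)) + p * (I i - τ i * M) := by ring
      rw [z5]
      have z6 : C5 * e * R = τm * (D * (C3 * e) * (ED * D * R)) + D * (Ce * R) * (C0 * e) := by rw [hC5]; ring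
      rw [z6]
      linarith
    rw [Finset.sum_neg_distrib, ← Finset.sum_mul] at s3
    have : (∑ i ∈ Aᶜ, K i) * (C5 * e * R) ≤ Kt * (C5 * e * R) := by gcongr
    linarith
  have T34 : -(D * Ce * R * X) ≤ ∑ j ∈ W, η j * (m j * u t j) + ∑ i ∈ A, (∑ j, η j * (y i j : ℝ)) * (K i * I i) := by
    have s1 : ∑ j ∈ W, -(D * Ce * R * (m j * u t j)) ≤ ∑ j ∈ W, η j * (m j * u t j) := by
      apply Finset.sum_le_sum
      intro j _
      have b : 0 ≤ m j * u t j := mul_nonneg (h.hm j).le (h.pos t j).le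
      have b2 : |η j| ≤ D * Ce * R := (hη2 j).trans (by
        have : 0 ≤ Ce * R := by positivity
        nlinarith)
      exact mul_lower b2 (le_of_eq (abs_of_nonneg b))
    have s2 : ∑ i ∈ A, -(D * Ce * R * (K i * I i)) ≤ ∑ i ∈ A, (∑ j, η j * (y i j : ℝ)) * (K i * I i) := by
      apply Finset.sum_le_sum
      intro i _
      have b : 0 ≤ K i * I i := mul_nonneg (h.hK i).le (hI0 i)
      have y2 : |∑ j, η j * (y i j : ℝ)| ≤ D * (Ce * R) := abs_dot_le η (y i) (by positivity) (hD i).1 (fun j _ => hη2 j)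
      rw [← mul_assoc] at y2
      exact mul_lower y2 (le_of_eq (abs_of_nonneg b))
    rw [Finset.sum_neg_distrib, ← Finset.mul_sum] at s1 s2
    rw [hXe, mul_add]
    linarith
  have hRle : R ≤ C8 * (e + X) := by
    have f1 : S / (2 * cm) ≤ C6 * (e + X) * R := by
      have f2 : S / (2 * cm) ≤ (2 * Mt * C3 + Kt * C5) * e * R + D * Ce * R * X := by
        have : (2 * Mt * C3 + Kt * C5) * e * R = Mt * (C3 * e * (2 * R)) + Kt * (C5 * e * R) := by ring
        linarith
      refine f2.trans ?_
      have g1 : 0 ≤ (2 * Mt * C3 + Kt * C5) * X * R := by positivity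
      have g2 : 0 ≤ D * Ce * e * R := by positivity
      have : C6 * (e + X) * R = (2 * Mt * C3 + Kt * C5) * e * R + D * Ce * R * X + (2 * Mt * C3 + Kt * C5) * X * R + D * Ce * e * R := by
        rw [hC6]; ring
      linarith
    rw [div_le_iff₀ (by positivity), ← hRS] at f1
    rcases hR0.eq_or_lt with h0 | h0
    · rw [← h0]; positivity
    · have : R * R ≤ (C8 * (e + X)) * R := by rw [hC8]; nlinarith
      exact le_of_mul_le_mul_right this h0
  have heX : 0 ≤ e + X := by positivity
  constructor
  · intro j hj
    obtain ⟨l1, l2, l3, l4⟩ := log_facts (hnear j hj)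
    rw [← ξC j hj] at l3
    calc |u t j - 1| ≤ 2 * |ξ j| := l3
      _ ≤ 2 * (C8 * (e + X)) := by gcongr; exact (ξR j).trans hRle
      _ = (2 * C8) * (e + X) := by ring
      _ ≤ _ := by gcongr; nlinarith [mul_nonneg (mul_nonneg (zero_le_one.trans hED1) (zero_le_one.trans hD1)) hC8p]
  · intro i hi s hs
    have x2 := (hM1 i hi).2
    have x3 := q2 s hs i
    calc |mono (u s) (y i) - 1| = |(mono (u s) (y i) - mono (u t) (y i)) + (mono (u t) (y i) - 1)| := by ring_nf
      _ ≤ |mono (u s) (y i) - mono (u t) (y i)| + |mono (u t) (y i) - 1| := abs_add_le _ _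
      _ ≤ C0 * e + ED * D * R := by gcongr
      _ ≤ C0 * (e + X) + ED * D * (C8 * (e + X)) := by gcongr; linarith
      _ = (C0 + ED * D * C8) * (e + X) := by ring
      _ ≤ _ := by gcongr; linarith

end Csec2

def Near (τm : ℝ) (u : ℝ → Fin n → ℝ) (W : Finset (Fin n)) (δ t : ℝ) : Prop :=
  ∀ s ∈ Set.Icc (t - (τm + 1)) t, ∀ j, |u s j - (if j ∈ W then 0 else 1)| ≤ δ

theorem g_small {ε : ℝ} (hε : 0 < ε) : ∃ δ, 0 < δ ∧ ∀ a, 0 < a → a ≤ δ →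
    a ≤ ε ∧ 1 - hh a ≤ ε ∧ a ≤ ε * (1 - hh a) := by
  have h0 : hh 0 = 1 := by simp [hh]
  obtain ⟨d, hd, hd2⟩ := Metric.continuous_iff.1 hh_cont 0 ε hε
  refine ⟨min (min (d / 2) ε) (Real.exp (1 - 1 / ε)), by positivity, fun a ha hle => ?_⟩
  have l1 : a ≤ d / 2 := hle.trans ((min_le_left _ _).trans (min_le_left _ _))
  have l2 : a ≤ ε := hle.trans ((min_le_left _ _).trans (min_le_right _ _))
  have l3 : a ≤ Real.exp (1 - 1 / ε) := hle.trans (min_le_right _ _)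
  refine ⟨l2, ?_, ?_⟩
  · have := hd2 a (by rw [Real.dist_eq, sub_zero, abs_of_pos ha]; linarith)
    rw [h0, Real.dist_eq] at this
    have := (abs_lt.1 this).1
    linarith
  · have l4 : Real.log a ≤ 1 - 1 / ε := by
      have := Real.log_le_log ha l3
      rwa [Real.log_exp] at this
    have l5 : 1 - hh a = a * (1 - Real.log a) := by unfold hh; ring
    rw [l5]
    have l6 : 1 / ε ≤ 1 - Real.log a := by linarith
    rw [div_le_iff₀ hε] at l6
    nlinarith

section Csec3
variable {y y' : Fin r → Fin n → ℕ} {K τ : Fin r → ℝ} {m : Fin n → ℝ} {τm Mb : ℝ}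
    {u : ℝ → Fin n → ℝ} {W : Finset (Fin n)} {A : Finset (Fin r)} {tN : ℕ → ℝ}

theorem Ctx.S2 (c : Ctx y y' K τ m τm Mb u W A tN) {ε : ℝ} (hε : 0 < ε) :
    ∃ δ, 0 < δ ∧ δ ≤ 1 / 2 ∧ ∀ t, Near τm u W δ t →
      Phi y K τ m u W A (fun a => 1 - hh a) t ≤ ε ∧ Phi y K τ m u W A (fun a => a) t ≤ ε ∧
      Phi y K τ m u W A (fun a => a) t ≤ ε * Phi y K τ m u W A (fun a => 1 - hh a) t := by
  have h := c.ns
  set Z := 1 + (∑ j ∈ W, m j + ∑ i ∈ A, K i * τ i) with hZ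
  have hZ0 : 0 ≤ ∑ j ∈ W, m j + ∑ i ∈ A, K i * τ i := add_nonneg (Finset.sum_nonneg (fun j _ => (h.hm j).le))
    (Finset.sum_nonneg (fun i _ => mul_nonneg (h.hK i).le (h.hτ i)))
  have hZ1 : 1 ≤ Z := by linarith
  have hZp : 0 < Z := by linarith
  obtain ⟨δ, hδ, hg⟩ := g_small (ε := ε / Z) (by positivity)
  obtain ⟨L, hL1, hL⟩ := mono_le_coord Mb h.hMb y
  have hLp : 0 < L := by linarith
  have hεZ : ε / Z ≤ ε := div_le_self hε.le hZ1
  have hbd : ε / Z * (∑ j ∈ W, m j + ∑ i ∈ A, K i * τ i) ≤ ε := by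
    rw [div_mul_eq_mul_div, div_le_iff₀ hZp]
    nlinarith
  have c1 : Continuous (fun a : ℝ => 1 - hh a) := continuous_const.sub hh_cont
  refine ⟨min (δ / L) (1 / 2), by positivity, min_le_right _ _, fun t hn => ?_⟩
  have hδL : δ / L ≤ δ := div_le_self hδ.le hL1
  have hu : ∀ s ∈ Set.Icc (t - (τm + 1)) t, ∀ j ∈ W, u s j ≤ δ / L := by
    intro s hs j hj
    have := hn s hs j
    rw [if_pos hj, sub_zero] at this
    exact (le_abs_self _).trans (this.trans (min_le_left _ _))
  have ht : t ∈ Set.Icc (t - (τm + 1)) t := ⟨by linarith [h.hτm0], le_rfl⟩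
  have g1 : ∀ j ∈ W, u t j ≤ ε / Z ∧ 1 - hh (u t j) ≤ ε / Z ∧ u t j ≤ ε / Z * (1 - hh (u t j)) :=
    fun j hj => hg _ (h.pos t j) ((hu t ht j hj).trans hδL)
  have g2 : ∀ i ∈ A, ∀ s ∈ Set.Icc (t - (τm + 1)) t, mono (u s) (y i) ≤ ε / Z ∧ 1 - hh (mono (u s) (y i)) ≤ ε / Z ∧ mono (u s) (y i) ≤ ε / Z * (1 - hh (mono (u s) (y i))) := by
    intro i hi s hs
    obtain ⟨w, hw, hwy⟩ := (c.hA i).1 hi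
    apply hg _ (h.mpos _ _)
    have a1 := hL i (u s) w (fun j => (h.pos s j).le) (h.bdd s) hwy
    have a2 := hu s hs w hw
    rw [le_div_iff₀ hLp] at a2
    linarith
  have k3 := h.Phi_mono (W := W) (A := A) (f := fun a => a) (g := fun a => ε / Z * (1 - hh a)) continuous_id (continuous_const.mul c1)
    (fun j hj => (g1 j hj).2.2) (fun i hi s hs => (g2 i hi s hs).2.2)
  have k1 := h.Phi_mono (W := W) (A := A) (f := fun a => 1 - hh a) (g := fun a => ε / Z) c1 continuous_const
    (fun j hj => (g1 j hj).2.1) (fun i hi s hs => (g2 i hi s hs).2.1)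
  have k2 := h.Phi_mono (W := W) (A := A) (f := fun a => a) (g := fun a => ε / Z) continuous_id continuous_const
    (fun j hj => (g1 j hj).1) (fun i hi s hs => (g2 i hi s hs).1)
  have k4 := h.Phi_mono (W := W) (A := A) (f := fun a => 0) (g := fun a => a) (t := t) continuous_const continuous_id
    (fun j hj => (h.pos t j).le) (fun i hi s hs => (h.mpos _ _).le)
  rw [Phi_const] at k1 k2 k4
  rw [Phi_smul] at k3
  refine ⟨k1.trans hbd, k2.trans hbd, k3.trans ?_⟩
  have : 0 ≤ Phi y K τ m u W A (fun a => 1 - hh a) t := by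
    have : 0 < ε / Z := by positivity
    by_contra hc
    nlinarith
  gcongr

theorem Ctx.X_lower (c : Ctx y y' K τ m τm Mb u W A tN) (t : ℝ) :
    0 < Phi y K τ m u W A (fun a => a) t ∧ ∀ j ∈ W, m j * u t j ≤ Phi y K τ m u W A (fun a => a) t := by
  have h := c.ns
  have h1 : ∀ j ∈ W, m j * u t j ≤ Phi y K τ m u W A (fun a => a) t := by
    intro j hj
    have a1 := Finset.single_le_sum (f := fun j => m j * u t j) (fun j _ => mul_nonneg (h.hm j).le (h.pos t j).le) hj
    have a2 : 0 ≤ ∑ i ∈ A, K i * ∫ s in (t - τ i)..t, mono (u s) (y i) :=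
      Finset.sum_nonneg (fun i _ => mul_nonneg (h.hK i).le
        (intervalIntegral.integral_nonneg (by linarith [h.hτ i]) (fun s _ => (h.mpos _ s).le)))
    unfold Phi
    exact a1.trans (by linarith)
  obtain ⟨w, hw⟩ := c.hW
  exact ⟨lt_of_lt_of_le (mul_pos (h.hm w) (h.pos t w)) (h1 w hw), h1⟩

theorem Ctx.Yeq (c : Ctx y y' K τ m τm Mb u W A tN) (t : ℝ) :
    Phi y K τ m u W A (fun a => 1 - hh a) t = (∑ j ∈ W, m j + ∑ i ∈ A, K i * τ i) - Hf y K τ m u W A t := by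
  rw [c.ns.Phi_sub continuous_const hh_cont, Phi_const, one_mul]
  rfl

theorem Ctx.Deq (c : Ctx y y' K τ m τm Mb u W A tN) (t : ℝ) :
    Hf y K τ m u univ univ t - (∑ j ∈ W, m j + ∑ i ∈ A, K i * τ i) =
    Hf y K τ m u Wᶜ Aᶜ t - Phi y K τ m u W A (fun a => 1 - hh a) t := by
  rw [c.Yeq]
  have := Phi_split (y := y) (K := K) (τ := τ) (m := m) (u := u) W A hh t
  change Hf y K τ m u univ univ t = Hf y K τ m u W A t + Hf y K τ m u Wᶜ Aᶜ t at this
  linarith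

theorem Ctx.near_tN (c : Ctx y y' K τ m τm Mb u W A tN) {δ : ℝ} (hδ : 0 < δ) :
    ∀ᶠ N in atTop, Near τm u W δ (tN N) := by
  obtain ⟨C, hC1, hC⟩ := c.ns.core2
  have hq : Tendsto (fun N => C * √(qf y K τ m τm u (tN N))) atTop (nhds 0) := by
    have := (c.ns.q_tendsto.comp c.htN).const_mul C
    simpa [qf, Function.comp_def] using this
  have h1 : ∀ᶠ N in atTop, ∀ j, |u (tN N) j - (if j ∈ W then 0 else 1)| < δ / 2 := by
    rw [Filter.eventually_all]
    intro j
    have := (Metric.tendsto_nhds.1 (c.lim j)) (δ / 2) (by positivity)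
    exact this
  filter_upwards [h1, hq.eventually_lt_const (show (0:ℝ) < δ / 2 by positivity), c.htN.eventually_gt_atTop (τm + 1)] with N a1 a2 a3
  intro s hs j
  have b := (hC _ a3).2.1 s hs j
  have b1 := a1 j
  calc |u s j - (if j ∈ W then 0 else 1)| = |(u s j - u (tN N) j) + (u (tN N) j - (if j ∈ W then 0 else 1))| := by ring_nf
    _ ≤ _ := abs_add_le _ _
    _ ≤ δ := by linarith

theorem Ctx.S5 (c : Ctx y y' K τ m τm Mb u W A tN) {t : ℝ} (ht : 0 < t) :
    0 ≤ Hf y K τ m u univ univ t - (∑ j ∈ W, m j + ∑ i ∈ A, K i * τ i) := by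
  apply le_of_forall_pos_le_add
  intro ε hε
  obtain ⟨δ, hδ, _, h2⟩ := c.S2 hε
  obtain ⟨N, hN1, hN2⟩ := ((c.near_tN hδ).and (c.htN.eventually_gt_atTop t)).exists
  have h3 := (h2 _ hN1).1
  have h4 := c.ns.V_anti (Set.mem_Ioi.2 ht) (Set.mem_Ioi.2 (ht.trans hN2)) hN2.le
  have h5 := c.Deq (tN N)
  have h6 := c.ns.Hf_nonneg Wᶜ Aᶜ (tN N)
  linarith

set_option maxHeartbeats 2000000 in
theorem Ctx.S4 (c : Ctx y y' K τ m τm Mb u W A tN) :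
    ∃ δ C, 0 < δ ∧ 1 ≤ C ∧ ∀ t, τm + 1 < t → Near τm u W δ t →
      Phi y K τ m u W A (fun a => 1 - hh a) t ≤ C * qf y K τ m τm u t ∧
      Hf y K τ m u univ univ t - (∑ j ∈ W, m j + ∑ i ∈ A, K i * τ i) ≤ C * qf y K τ m τm u t ∧
      ∀ j, |u t j - (if j ∈ W then 0 else 1)| ≤ C * (√(qf y K τ m τm u t) + qf y K τ m τm u t) := by
  have h := c.ns
  obtain ⟨C, hC1, hC⟩ := c.S1
  obtain ⟨C0, hC01, hC0⟩ := h.core2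
  obtain ⟨cm, hcm1, hcm⟩ : ∃ D, 1 ≤ D ∧ ∀ j, 1 / m j ≤ D :=
    exists_unif (fun _ _ _ h1 h2 => h2.trans h1) (fun j => ⟨_, le_rfl⟩)
  set ZB := ∑ j ∈ Wᶜ, m j + ∑ i ∈ Aᶜ, K i * τ i with hZB
  have hZB0 : 0 ≤ ZB := add_nonneg (Finset.sum_nonneg (fun j _ => (h.hm j).le))
    (Finset.sum_nonneg (fun i _ => mul_nonneg (h.hK i).le (h.hτ i)))
  set C9 := C ^ 2 * (ZB + 1) with hC9
  have hC91 : 1 ≤ C9 := by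
    have : 1 ≤ C ^ 2 := one_le_pow₀ hC1
    nlinarith
  obtain ⟨δ, hδ, hδ2, hS2⟩ := c.S2 (ε := 1 / (4 * C9)) (by positivity)
  have hbig : 1 ≤ C9 * C := one_le_mul_of_one_le_of_one_le hC91 hC1
  refine ⟨δ, 4 * (C9 * C * cm), hδ, by nlinarith [one_le_mul_of_one_le_of_one_le hbig hcm1], fun t ht hn => ?_⟩
  obtain ⟨s1, s2, s3⟩ := hS2 t hn
  have hX := c.X_lower t
  have htm : t ∈ Set.Icc (t - (τm + 1)) t := ⟨by linarith [h.hτm0], le_rfl⟩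
  have hq0 := (hC0 t ht).1
  have hD0 := c.S5 (t := t) (by linarith [h.hτm0])
  have hDeq := c.Deq t
  obtain ⟨r1, r2⟩ := hC t ht (fun j hj => by
    have := hn t htm j
    rw [if_neg hj] at this
    exact this.trans hδ2) _ _ rfl rfl
  set q := qf y K τ m τm u t with hq
  set e := √q with he
  have he0 : 0 ≤ e := Real.sqrt_nonneg _
  have heq : e ^ 2 = q := Real.sq_sqrt hq0
  set X := Phi y K τ m u W A (fun a => a) t
  set Y := Phi y K τ m u W A (fun a => 1 - hh a) t
  have hVB : Hf y K τ m u Wᶜ Aᶜ t ≤ (C * (e + X)) ^ 2 * ZB := by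
    have := h.Phi_mono (W := Wᶜ) (A := Aᶜ) (f := hh) (g := fun _ => (C * (e + X)) ^ 2) (t := t) hh_cont continuous_const
      (fun j hj => (hh_le (h.pos t j)).trans (sq_le_sq.2 ((r1 j (Finset.mem_compl.1 hj)).trans (le_abs_self _))))
      (fun i hi s hs => (hh_le (h.mpos _ _)).trans (sq_le_sq.2 ((r2 i (Finset.mem_compl.1 hi) s hs).trans (le_abs_self _))))
    rwa [Phi_const] at this
  have hVB2 : Hf y K τ m u Wᶜ Aᶜ t ≤ C9 * (e + X) ^ 2 := by
    refine hVB.trans ?_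
    rw [hC9, mul_pow]
    have : 0 ≤ C ^ 2 * (e + X) ^ 2 := by positivity
    nlinarith
  have hX0 := hX.1
  have f4 : (4 * C9) * (1 / (4 * C9)) = 1 := by field_simp
  have hε1 : 1 / (4 * C9) ≤ 1 := by rw [div_le_one (by positivity)]; linarith
  have hYX : X ≤ Y := by
    have hY0 : 0 ≤ Y := by
      have : 0 < 1 / (4 * C9) := by positivity
      by_contra hc; nlinarith
    nlinarith
  have hX2 : 2 * C9 * X ^ 2 ≤ Y / 2 := by
    have b1 : C9 * X ≤ 1 / 4 := by
      have := mul_le_mul_of_nonneg_left s2 (show (0:ℝ) ≤ 4 * C9 by positivity)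
      linarith
    nlinarith
  have hVB3 : Hf y K τ m u Wᶜ Aᶜ t ≤ 2 * C9 * q + Y / 2 := by
    have : (e + X) ^ 2 ≤ 2 * e ^ 2 + 2 * X ^ 2 := by nlinarith [sq_nonneg (e - X)]
    rw [heq] at this
    have := mul_le_mul_of_nonneg_left this (zero_le_one.trans hC91)
    linarith
  have hY : Y ≤ 4 * C9 * q := by linarith
  have hD : Hf y K τ m u univ univ t - (∑ j ∈ W, m j + ∑ i ∈ A, K i * τ i) ≤ 4 * C9 * q := by linarith
  have hc1 : 4 * C9 ≤ 4 * (C9 * C * cm) := by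
    have : C9 ≤ C9 * (C * cm) := le_mul_of_one_le_right (by linarith) (one_le_mul_of_one_le_of_one_le hC1 hcm1)
    linarith
  have hc2 : 4 * (C9 * C) ≤ 4 * (C9 * C * cm) := by
    have : C9 * C ≤ C9 * C * cm := le_mul_of_one_le_right (by linarith) hcm1
    linarith
  have hc3 : 4 * (C9 * cm) ≤ 4 * (C9 * C * cm) := by
    have : C9 * cm ≤ C9 * cm * C := le_mul_of_one_le_right (by positivity) hC1
    linarith
  refine ⟨hY.trans (by gcongr), hD.trans (by gcongr), fun j => ?_⟩
  by_cases hj : j ∈ W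
  · rw [if_pos hj, sub_zero, abs_of_pos (h.pos t j)]
    have b1 := hX.2 j hj
    have b2 : u t j ≤ cm * X := by
      calc u t j = (1 / m j) * (m j * u t j) := by field_simp [(h.hm j).ne']
        _ ≤ (1 / m j) * X := by gcongr; exact one_div_nonneg.2 (h.hm j).le
        _ ≤ cm * X := by gcongr; exact hcm j
    calc u t j ≤ cm * (4 * C9 * q) := b2.trans (by gcongr; linarith)
      _ = 4 * (C9 * cm) * q := by ring
      _ ≤ 4 * (C9 * C * cm) * (e + q) := by gcongr; linarith
  · rw [if_neg hj]
    calc |u t j - 1| ≤ C * (e + X) := r1 j hj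
      _ ≤ C * (4 * C9 * (e + q)) := by
        gcongr
        nlinarith
      _ = 4 * (C9 * C) * (e + q) := by ring
      _ ≤ _ := by gcongr

end Csec3

section Csec4
variable {y y' : Fin r → Fin n → ℕ} {K τ : Fin r → ℝ} {m : Fin n → ℝ} {τm Mb : ℝ}
    {u : ℝ → Fin n → ℝ} {W : Finset (Fin n)} {A : Finset (Fin r)} {tN : ℕ → ℝ}

theorem NS.e_tendsto (h : NS y y' K τ m τm Mb u) :
    Tendsto (fun t => √(qf y K τ m τm u t)) atTop (nhds 0) := by
  simpa [qf] using h.q_tendsto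

theorem NS.eq_tendsto (h : NS y y' K τ m τm Mb u) (C : ℝ) :
    Tendsto (fun t => C * (√(qf y K τ m τm u t) + qf y K τ m τm u t)) atTop (nhds 0) := by
  obtain ⟨C0, hC01, hC0⟩ := h.core2
  have h1 := h.e_tendsto
  have h2 : Tendsto (fun t => qf y K τ m τm u t) atTop (nhds 0) := by
    have h3 := h1.pow 2
    rw [zero_pow two_ne_zero] at h3
    refine h3.congr' ?_
    filter_upwards [eventually_gt_atTop (τm + 1)] with t ht
    exact Real.sq_sqrt (hC0 t ht).1
  have := (h1.add h2).const_mul C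
  simpa using this

theorem Ctx.S6 (c : Ctx y y' K τ m τm Mb u W A tN) {δ : ℝ} (hδ : 0 < δ) :
    ∀ᶠ t in atTop, Near τm u W δ t := by
  have h := c.ns
  obtain ⟨δ1, C4, hδ1, hC41, hS4⟩ := c.S4
  obtain ⟨C0, hC01, hC0⟩ := h.core2
  have e1 : Tendsto (fun t => C0 * √(qf y K τ m τm u t)) atTop (nhds 0) := by
    simpa using h.e_tendsto.const_mul C0
  have e2 := h.eq_tendsto C4
  have hτm0 := h.hτm0
  have ev : ∀ᶠ t in atTop, τm + 1 < t ∧ C0 * √(qf y K τ m τm u t) ≤ δ1 / 4 ∧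
      C4 * (√(qf y K τ m τm u t) + qf y K τ m τm u t) ≤ δ1 / 4 := by
    filter_upwards [eventually_gt_atTop (τm + 1), e1.eventually_lt_const (show (0:ℝ) < δ1 / 4 by positivity),
      e2.eventually_lt_const (show (0:ℝ) < δ1 / 4 by positivity)] with t a1 a2 a3
    exact ⟨a1, a2.le, a3.le⟩
  obtain ⟨t0, ht0⟩ := eventually_atTop.1 ev
  have step : ∀ t ≥ t0, Near τm u W δ1 t → ∀ t' ∈ Set.Icc t (t + (τm + 1)), Near τm u W δ1 t' := by
    intro t ht hn t' ht' s hs j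
    obtain ⟨b1, b2, b3⟩ := ht0 t ht
    obtain ⟨d1, d2, d3⟩ := ht0 t' (ht.le.trans ht'.1)
    have f1 := (hS4 t b1 hn).2.2 j
    have f2 := (hC0 t' d1).2.1 s hs j
    have f3 := (hC0 t' d1).2.1 t ⟨by linarith [ht'.2], ht'.1⟩ j
    have f4 : |u s j - (if j ∈ W then 0 else 1)| ≤ |u s j - u t' j| + |u t j - u t' j| + |u t j - (if j ∈ W then 0 else 1)| := by
      calc |u s j - (if j ∈ W then 0 else 1)| = |(u s j - u t' j) - (u t j - u t' j) + (u t j - (if j ∈ W then 0 else 1))| := by ring_nf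
        _ ≤ |(u s j - u t' j) - (u t j - u t' j)| + |u t j - (if j ∈ W then 0 else 1)| := abs_add_le _ _
        _ ≤ _ := by gcongr; exact abs_sub _ _
    linarith
  obtain ⟨N, hN1, hN2⟩ := ((c.near_tN hδ1).and (c.htN.eventually_ge_atTop t0)).exists
  have hk : ∀ k : ℕ, Near τm u W δ1 (tN N + k * (τm + 1)) := by
    intro k
    induction k with
    | zero => simpa using hN1
    | succ k ih =>
      apply step _ _ ih
      · push_cast
        exact ⟨by linarith, by linarith⟩
      · have : 0 ≤ (k : ℝ) * (τm + 1) := by positivity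
        linarith
  have hall : ∀ t ≥ tN N, Near τm u W δ1 t := by
    intro t ht
    have hT : 0 < τm + 1 := by linarith
    have f1 := Nat.floor_le (div_nonneg (sub_nonneg.2 ht) hT.le)
    have f2 := Nat.lt_floor_add_one ((t - tN N) / (τm + 1))
    rw [le_div_iff₀ hT] at f1
    rw [div_lt_iff₀ hT] at f2
    have : 0 ≤ (⌊(t - tN N) / (τm + 1)⌋₊ : ℝ) * (τm + 1) := by positivity
    exact step _ (by linarith) (hk ⌊(t - tN N) / (τm + 1)⌋₊) t ⟨by linarith, by linarith⟩
  filter_upwards [eventually_ge_atTop (tN N), eventually_gt_atTop (τm + 1), e1.eventually_lt_const (show (0:ℝ) < δ / 2 by positivity),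
      e2.eventually_lt_const (show (0:ℝ) < δ / 2 by positivity)] with t a1 a2 a3 a4
  intro s hs j
  have f1 := (hS4 t a2 (hall t a1)).2.2 j
  have f2 := (hC0 t a2).2.1 s hs j
  have f4 : |u s j - (if j ∈ W then 0 else 1)| ≤ |u s j - u t j| + |u t j - (if j ∈ W then 0 else 1)| := by
    calc |u s j - (if j ∈ W then 0 else 1)| = |(u s j - u t j) + (u t j - (if j ∈ W then 0 else 1))| := by ring_nf
      _ ≤ _ := abs_add_le _ _
  linarith

theorem Ctx.balA (c : Ctx y y' K τ m τm Mb u W A tN) (t : ℝ) :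
    ∑ i ∈ A, K i * mono (u t) (y i) = ∑ i ∈ A, K i * mono (u t) (y' i) := by
  classical
  have := c.ns.bal (fun z => if ∃ j ∈ W, z j ≠ 0 then mono (u t) z else 0)
  have g1 : ∑ i ∈ A, K i * mono (u t) (y i) = ∑ i, K i * (if ∃ j ∈ W, y i j ≠ 0 then mono (u t) (y i) else 0) := by
    rw [← Finset.sum_subset (Finset.subset_univ A)]
    · exact Finset.sum_congr rfl (fun i hi => by rw [if_pos ((c.hA i).1 hi)])
    · intro i _ hi
      rw [if_neg (fun hc => hi ((c.hA i).2 hc)), mul_zero]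
  have g2 : ∑ i ∈ A, K i * mono (u t) (y' i) = ∑ i, K i * (if ∃ j ∈ W, y' i j ≠ 0 then mono (u t) (y' i) else 0) := by
    rw [← Finset.sum_subset (Finset.subset_univ A)]
    · exact Finset.sum_congr rfl (fun i hi => by rw [if_pos ((c.hA' i).1 hi)])
    · intro i _ hi
      rw [if_neg (fun hc => hi ((c.hA' i).2 hc)), mul_zero]
  rw [g1, g2]
  exact this

set_option maxHeartbeats 1000000 in
theorem Ctx.S7 (c : Ctx y y' K τ m τm Mb u W A tN) :
    ∃ C, 1 ≤ C ∧ ∀ δ, 0 < δ → δ ≤ 1 / 2 → ∀ t, τm < t → Near τm u W δ t →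
      Phi y K τ m u W A (fun a => a) t ≤ Phi y K τ m u W A (fun a => 1 - hh a) t →
      ∃ d, HasDerivAt (Phi y K τ m u W A (fun a => 1 - hh a)) d t ∧
        -(C * δ) * Phi y K τ m u W A (fun a => 1 - hh a) t ≤ d := by
  have h := c.ns
  obtain ⟨L, hL1, hL⟩ := mono_le_coord Mb h.hMb y
  obtain ⟨Cd, hCd1, hCd⟩ := h.decay
  obtain ⟨D, hD1, hD⟩ : ∃ D, 1 ≤ D ∧ ∀ i, ∑ j, (y i j : ℝ) ≤ D ∧ ∑ j, (y' i j : ℝ) ≤ D :=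
    exists_unif (fun _ _ _ h1 h2 => ⟨h2.1.trans h1, h2.2.trans h1⟩)
      (fun i => ⟨max (∑ j, (y i j : ℝ)) (∑ j, (y' i j : ℝ)), le_max_left _ _, le_max_right _ _⟩)
  obtain ⟨cm, hcm1, hcm⟩ : ∃ D, 1 ≤ D ∧ ∀ j, 1 / m j ≤ D :=
    exists_unif (fun _ _ _ h1 h2 => h2.trans h1) (fun j => ⟨_, le_rfl⟩)
  have hτm0 := h.hτm0
  set E := Real.exp (Cd * τm) with hE
  have hE1 : 1 ≤ E := Real.one_le_exp (by positivity)
  set Q := L * (E * cm) with hQ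
  have hQ0 : 0 ≤ Q := by positivity
  set KA := ∑ i ∈ A, K i with hKA
  have hKA0 : 0 ≤ KA := Finset.sum_nonneg (fun i _ => (h.hK i).le)
  refine ⟨1 + KA * (4 * D * Q), by linarith [mul_nonneg hKA0 (show 0 ≤ 4 * D * Q by positivity)], fun δ hδ hδ2 t ht hn hXY => ?_⟩
  have ht0 : 0 < t := by linarith
  have hX := c.X_lower t
  have hd := h.Hf_deriv W A c.hAW ht0 (c.balA t)
  have hd2 := hd.const_sub (∑ j ∈ W, m j + ∑ i ∈ A, K i * τ i)
  have hfe : Phi y K τ m u W A (fun a => 1 - hh a) = fun t => (∑ j ∈ W, m j + ∑ i ∈ A, K i * τ i) - Hf y K τ m u W A t :=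
    funext c.Yeq
  rw [← hfe] at hd2
  refine ⟨_, hd2, ?_⟩
  set X := Phi y K τ m u W A (fun a => a) t
  set Y := Phi y K τ m u W A (fun a => 1 - hh a) t
  have hY0 : 0 < Y := hX.1.trans_le hXY
  have htm : t ∈ Set.Icc (t - (τm + 1)) t := ⟨by linarith [h.hτm0], le_rfl⟩
  have uY : ∀ j ∈ W, u t j ≤ cm * Y := by
    intro j hj
    have b1 := hX.2 j hj
    have hm1 : 0 ≤ 1 / m j := one_div_nonneg.2 (h.hm j).le
    calc u t j = (1 / m j) * (m j * u t j) := by field_simp [(h.hm j).ne']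
      _ ≤ (1 / m j) * Y := mul_le_mul_of_nonneg_left (b1.trans hXY) hm1
      _ ≤ cm * Y := mul_le_mul_of_nonneg_right (hcm j) hY0.le
  have MY : ∀ i ∈ A, |mono (u (t - τ i)) (y i)| ≤ Q * Y ∧ |mono (u t) (y i)| ≤ Q * Y := by
    intro i hi
    obtain ⟨w, hw, hwy⟩ := (c.hA i).1 hi
    have l1 := hL i (u t) w (fun j => (h.pos t j).le) (h.bdd t) hwy
    have l2 := hL i (u (t - τ i)) w (fun j => (h.pos _ j).le) (h.bdd _) hwy
    have hτi := h.hτ i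
    have hτi2 := h.hτm i
    have l3 := hCd (t - τ i) t (by linarith) (by linarith) w
    rw [sub_sub_cancel] at l3
    have l4 : u (t - τ i) w ≤ E * u t w := by
      have k1 : Real.exp (-Cd * τ i) * Real.exp (Cd * τ i) = 1 := by rw [← Real.exp_add]; simp
      have k2 : Real.exp (Cd * τ i) ≤ E := Real.exp_le_exp.2 (by gcongr)
      calc u (t - τ i) w = (u (t - τ i) w * Real.exp (-Cd * τ i)) * Real.exp (Cd * τ i) := by rw [mul_assoc, k1, mul_one]
        _ ≤ u t w * Real.exp (Cd * τ i) := by gcongr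
        _ ≤ u t w * E := by gcongr; exact (h.pos t w).le
        _ = _ := mul_comm _ _
    have l5 : u t w ≤ E * u t w := le_mul_of_one_le_left (h.pos t w).le hE1
    have l6 : L * (E * u t w) ≤ Q * Y := by
      calc L * (E * u t w) ≤ L * (E * (cm * Y)) := by gcongr; exact uY w hw
        _ = Q * Y := by rw [hQ]; ring
    rw [abs_of_pos (h.mpos _ _), abs_of_pos (h.mpos _ _)]
    exact ⟨l2.trans (le_trans (by gcongr) l6), l1.trans (le_trans (by gcongr) l6)⟩
  have logb : ∀ z : Fin n → ℕ, ∑ j, (z j : ℝ) ≤ D → |∑ j ∈ Wᶜ, (z j : ℝ) * Real.log (u t j)| ≤ D * (2 * δ) := by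
    intro z hz
    have e1 : ∑ j ∈ Wᶜ, (z j : ℝ) * Real.log (u t j) = ∑ j, (if j ∈ W then 0 else Real.log (u t j)) * (z j : ℝ) := by
      rw [← Finset.sum_subset (Finset.subset_univ Wᶜ)]
      · exact Finset.sum_congr rfl (fun j hj => by rw [if_neg (Finset.mem_compl.1 hj), mul_comm])
      · intro j _ hj
        rw [if_pos (by simpa using hj), zero_mul]
    rw [e1]
    apply abs_dot_le _ z (by positivity) hz
    intro j _
    by_cases hj : j ∈ W
    · rw [if_pos hj, abs_zero]; positivity
    · rw [if_neg hj]
      have := hn t htm j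
      rw [if_neg hj] at this
      have := (log_facts (this.trans hδ2)).2.2.2
      linarith
  have hs1 : 0 ≤ ∑ i ∈ A, K i * h2 (mono (u (t - τ i)) (y i)) (mono (u t) (y' i)) :=
    Finset.sum_nonneg (fun i _ => mul_nonneg (h.hK i).le (h2_nonneg (h.mpos _ _) (h.mpos _ _)))
  have hs2 : ∑ i ∈ A, -(K i * (4 * D * Q * δ * Y)) ≤ ∑ i ∈ A, K i * (mono (u (t - τ i)) (y i) * (∑ j ∈ Wᶜ, (y' i j : ℝ) * Real.log (u t j))
         - mono (u t) (y i) * (∑ j ∈ Wᶜ, (y i j : ℝ) * Real.log (u t j))) := by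
    apply Finset.sum_le_sum
    intro i hi
    rw [← mul_neg]
    apply mul_le_mul_of_nonneg_left _ (h.hK i).le
    have p1 := mul_lower (MY i hi).1 (logb (y' i) (hD i).2)
    have p2 := mul_lower (MY i hi).2 (show |-(∑ j ∈ Wᶜ, (y i j : ℝ) * Real.log (u t j))| ≤ D * (2 * δ) by rw [abs_neg]; exact logb (y i) (hD i).1)
    linarith
  rw [Finset.sum_neg_distrib, ← Finset.sum_mul, ← hKA] at hs2
  have : 0 ≤ δ * Y := by positivity
  have : -((1 + KA * (4 * D * Q)) * δ) * Y = -(δ * Y) - KA * (4 * D * Q * δ * Y) := by ring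
  linarith

theorem Ctx.absurd (c : Ctx y y' K τ m τm Mb u W A tN) : False := by
  have h := c.ns
  have hτm0 := h.hτm0
  obtain ⟨δ1, C4, hδ1, hC41, hS4⟩ := c.S4
  obtain ⟨C10, hC101, hS7⟩ := c.S7
  obtain ⟨δ2, hδ2, hδ22, hS2⟩ := c.S2 one_pos
  set T := τm + 1 with hT
  have hTp : 0 < T := by linarith
  set ε := 1 / (2 * T * (1 + C4)) with hε
  have hεp : 0 < ε := by positivity
  set δ := min (min δ1 δ2) (ε / C10) with hδ
  have hδp : 0 < δ := by
    have : 0 < ε / C10 := by positivity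
    simp [hδ, hδ1, hδ2, this]
  have d1 : δ ≤ δ1 := (min_le_left _ _).trans (min_le_left _ _)
  have d2 : δ ≤ δ2 := (min_le_left _ _).trans (min_le_right _ _)
  have d3 : C10 * δ ≤ ε := by
    have : δ ≤ ε / C10 := min_le_right _ _
    rw [le_div_iff₀ (by linarith)] at this
    linarith
  obtain ⟨t1, ht1⟩ := eventually_atTop.1 ((c.S6 hδp).and (eventually_gt_atTop T))
  have mono_near : ∀ t δ', δ ≤ δ' → Near τm u W δ t → Near τm u W δ' t := fun t δ' hd hn s hs j => (hn s hs j).trans hd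
  set Y := Phi y K τ m u W A (fun a => 1 - hh a) with hY
  set Dd : ℝ → ℝ := fun t => Hf y K τ m u univ univ t - (∑ j ∈ W, m j + ∑ i ∈ A, K i * τ i) with hDd
  have XY : ∀ t ≥ t1, Phi y K τ m u W A (fun a => a) t ≤ Y t := by
    intro t ht
    have := (hS2 t (mono_near t _ d2 (ht1 t ht).1)).2.2
    rwa [one_mul] at this
  have Ypos : ∀ t ≥ t1, 0 < Y t := fun t ht => (c.X_lower t).1.trans_le (XY t ht)
  have hder : ∀ t ≥ t1, ∃ d, HasDerivAt Y d t ∧ -ε * Y t ≤ d := by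
    intro t ht
    obtain ⟨d, k1, k2⟩ := hS7 δ hδp (d2.trans hδ22) t (by linarith [(ht1 t ht).2]) (ht1 t ht).1 (XY t ht)
    refine ⟨d, k1, le_trans ?_ k2⟩
    have := mul_le_mul_of_nonneg_right d3 (Ypos t ht).le
    linarith
  set σ := 1 - 1 / (2 * (1 + C4)) with hσ
  set ρ := C4 / (1 + C4) with hρ
  have hρ0 : 0 < ρ := by positivity
  have hρσ : ρ < σ := by
    rw [hρ, hσ, div_lt_iff₀ (by linarith)]
    have : 1 / (2 * (1 + C4)) * (1 + C4) = 1 / 2 := by field_simp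
    linarith
  have hσ0 : 0 < σ := hρ0.trans hρσ
  have Ystep : ∀ t ≥ t1, σ * Y t ≤ Y (t + T) := by
    intro t ht
    choose! f' hf' using hder
    have := decay_gen Y f' t (t + T) ε (by linarith)
      (fun s hs => (hf' s (ht.le.trans hs.1)).1.continuousAt.continuousWithinAt)
      (fun s hs => (hf' s (ht.le.trans hs.1.le)).1) (fun s hs => (hf' s (ht.le.trans hs.1.le)).2)
    rw [add_sub_cancel_left] at this
    have e1 := Real.add_one_le_exp (-ε * T)
    have e2 : -ε * T + 1 = σ := by rw [hε, hσ]; field_simp; ring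
    rw [e2] at e1
    have := mul_le_mul_of_nonneg_left e1 (Ypos t ht).le
    linarith
  have qe : ∀ t, qf y K τ m τm u (t + T) = Dd t - Dd (t + T) := by
    intro t
    simp only [qf, hDd, ← hT, add_sub_cancel_right]
    ring
  have Dstep : ∀ t ≥ t1, Dd (t + T) ≤ ρ * Dd t ∧ Y (t + T) ≤ C4 * Dd t := by
    intro t ht
    have h1 := ht1 (t + T) (by linarith)
    obtain ⟨k1, k2, _⟩ := hS4 (t + T) h1.2 (mono_near _ _ d1 h1.1)
    rw [qe] at k1 k2
    have k3 : 0 ≤ Dd (t + T) := c.S5 (by linarith [h1.2])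
    have k2' : Dd (t + T) ≤ C4 * (Dd t - Dd (t + T)) := k2
    constructor
    · rw [hρ, div_mul_eq_mul_div, le_div_iff₀ (by linarith)]
      linarith
    · have := mul_nonneg (zero_le_one.trans hC41) k3
      linarith
  have key : ∀ k : ℕ, σ ^ k * Y t1 ≤ Y (t1 + k * T) ∧ Dd (t1 + k * T) ≤ ρ ^ k * Dd t1 := by
    intro k
    induction k with
    | zero => simp
    | succ k ih =>
      have g : t1 + k * T ≥ t1 := by
        have : 0 ≤ (k:ℝ) * T := by positivity
        linarith
      have e : t1 + ((k + 1 : ℕ) : ℝ) * T = t1 + k * T + T := by push_cast; ring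
      rw [e]
      have a1 := Ystep _ g
      have a2 := (Dstep _ g).1
      constructor
      · calc σ ^ (k + 1) * Y t1 = σ * (σ ^ k * Y t1) := by ring
          _ ≤ σ * Y (t1 + k * T) := by gcongr; exact ih.1
          _ ≤ _ := a1
      · calc _ ≤ ρ * Dd (t1 + k * T) := a2
          _ ≤ ρ * (ρ ^ k * Dd t1) := by gcongr; exact ih.2
          _ = _ := by ring
  have fin : ∀ k : ℕ, σ * Y t1 ≤ (ρ / σ) ^ k * (C4 * Dd t1) := by
    intro k
    have g : t1 + k * T ≥ t1 := by
      have : 0 ≤ (k:ℝ) * T := by positivity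
      linarith
    have a1 := (Ystep _ g)
    have a2 := (Dstep _ g).2
    have a3 : σ ^ k * (σ * Y t1) ≤ ρ ^ k * (C4 * Dd t1) := by
      calc σ ^ k * (σ * Y t1) = σ * (σ ^ k * Y t1) := by ring
        _ ≤ σ * Y (t1 + k * T) := by gcongr; exact (key k).1
        _ ≤ C4 * Dd (t1 + k * T) := a1.trans a2
        _ ≤ C4 * (ρ ^ k * Dd t1) := by gcongr; exact (key k).2
        _ = _ := by ring
    rw [div_pow, div_mul_eq_mul_div, le_div_iff₀ (by positivity)]
    linarith
  have lim : Tendsto (fun k : ℕ => (ρ / σ) ^ k * (C4 * Dd t1)) atTop (nhds 0) := by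
    have := (tendsto_pow_atTop_nhds_zero_of_lt_one (by positivity) ((div_lt_one hσ0).2 hρσ)).mul_const (C4 * Dd t1)
    simpa using this
  have := ge_of_tendsto' lim fin
  have := mul_pos hσ0 (Ypos t1 le_rfl)
  linarith

end Csec4

theorem mono_div (a b : Fin n → ℝ) (z : Fin n → ℕ) (hb : ∀ j, 0 < b j) :
    mono (fun j => a j / b j) z * mono b z = mono a z := by
  unfold mono
  rw [← Finset.prod_mul_distrib]
  exact Finset.prod_congr rfl (fun j _ => by rw [div_pow, div_mul_cancel₀ _ (pow_pos (hb j) _).ne'])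

theorem cb_bal (y y' : Fin r → Fin n → ℕ) (K : Fin r → ℝ)
    (h : ∀ η : Fin n → ℕ, ∑ i ∈ Finset.univ.filter (fun i => y i = η), K i
      = ∑ i ∈ Finset.univ.filter (fun i => y' i = η), K i) (f : (Fin n → ℕ) → ℝ) :
    ∑ i, K i * f (y i) = ∑ i, K i * f (y' i) := by
  classical
  set T : Finset (Fin n → ℕ) := Finset.univ.image y ∪ Finset.univ.image y' with hT
  have g : ∀ z : Fin r → Fin n → ℕ, (∀ i, z i ∈ T) → ∑ i, K i * f (z i) =
      ∑ η ∈ T, (∑ i ∈ Finset.univ.filter (fun i => z i = η), K i) * f η := by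
    intro z hz
    rw [← Finset.sum_fiberwise_of_maps_to (s := Finset.univ) (t := T) (g := z) (fun i _ => hz i)]
    apply Finset.sum_congr rfl
    intro η _
    rw [Finset.sum_mul]
    apply Finset.sum_congr rfl
    intro i hi
    rw [(Finset.mem_filter.1 hi).2]
  rw [g y (fun i => by simp [hT]), g y' (fun i => by simp [hT])]
  exact Finset.sum_congr rfl (fun η _ => by rw [h η])

theorem sol_pos (y y' : Fin r → Fin n → ℕ) (k τ : Fin r → ℝ) (τm : ℝ)
    (hk : ∀ i, 0 < k i) (hτm : ∀ i, τ i ≤ τm) (hτm0 : 0 ≤ τm)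
    (x : ℝ → Fin n → ℝ) (hx : IsSolution y y' k τ τm x)
    (hxpos : PosInit τm x) (M : ℝ) (hM1 : 1 ≤ M) (hM : ∀ t ∈ Set.Ici (-τm), ∀ j, x t j ≤ M) :
    ∀ t ∈ Set.Ici (-τm), ∀ j, 0 < x t j := by
  obtain ⟨hnn, hcont, hder⟩ := hx
  obtain ⟨L, hL1, hL⟩ := mono_le_coord M hM1 y
  intro t ht j
  rcases le_total t 0 with h0 | h0
  · exact hxpos t ⟨ht, h0⟩ j
  have hin : ∀ s, 0 ≤ s → s ∈ Set.Ici (-τm) := fun s hs => by rw [Set.mem_Ici]; linarith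
  have hd : ∀ s > 0, HasDerivAt (fun s => x s j) (∑ i, k i * (mono (x (s - τ i)) (y i) * (y' i j : ℝ)
      - mono (x s) (y i) * (y i j : ℝ))) s := fun s hs => (hasDerivAt_pi.1 (hder s hs)) j
  have := decay_gen (fun s => x s j) _ 0 t (∑ i, k i * (L * (y i j : ℝ))) h0
    (fun s hs => ((continuousWithinAt_pi.1 (hcont s (hin s hs.1))) j).mono (fun s' hs' => hin s' hs'.1))
    (fun s hs => hd s hs.1) (by
      intro s hs
      rw [neg_mul, Finset.sum_mul, ← Finset.sum_neg_distrib]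
      apply Finset.sum_le_sum
      intro i _
      have hs0 : s ∈ Set.Ici (-τm) := hin s hs.1.le
      have p1 : 0 ≤ mono (x (s - τ i)) (y i) * (y' i j : ℝ) := by
        apply mul_nonneg _ (Nat.cast_nonneg _)
        exact Finset.prod_nonneg (fun j _ => pow_nonneg (hnn _ (by rw [Set.mem_Ici]; linarith [hτm i, hs.1]) j) _)
      have p2 : mono (x s) (y i) * (y i j : ℝ) ≤ L * x s j * (y i j : ℝ) := by
        by_cases hy : y i j = 0
        · simp [hy]
        · exact mul_le_mul_of_nonneg_right (hL i (x s) j (hnn s hs0) (hM s hs0) hy) (Nat.cast_nonneg _)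
      have p3 : k i * (-(L * x s j * (y i j : ℝ))) ≤ k i * (mono (x (s - τ i)) (y i) * (y' i j : ℝ)
        - mono (x s) (y i) * (y i j : ℝ)) := mul_le_mul_of_nonneg_left (by linarith) (hk i).le
      calc -(k i * (L * (y i j : ℝ)) * x s j) = k i * (-(L * x s j * (y i j : ℝ))) := by ring
        _ ≤ _ := p3)
  exact lt_of_lt_of_le (mul_pos (hxpos 0 ⟨by linarith, le_rfl⟩ j) (Real.exp_pos _)) this

theorem mkNS (y y' : Fin r → Fin n → ℕ) (k τ : Fin r → ℝ) (τm : ℝ)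
    (hk : ∀ i, 0 < k i) (hτ : ∀ i, 0 ≤ τ i) (hτm : ∀ i, τ i ≤ τm) (hτm0 : 0 ≤ τm)
    (x : ℝ → Fin n → ℝ) (hx : IsSolution y y' k τ τm x)
    (hpos : ∀ t ∈ Set.Ici (-τm), ∀ j, 0 < x t j) (M : ℝ) (hM : ∀ t ∈ Set.Ici (-τm), ∀ j, x t j ≤ M)
    (xh : Fin n → ℝ) (hxh : ∀ j, 0 < xh j)
    (hbal : ∀ f : (Fin n → ℕ) → ℝ, ∑ i, k i * mono xh (y i) * f (y i) = ∑ i, k i * mono xh (y i) * f (y' i)) :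
    ∃ Mb, NS y y' (fun i => k i * mono xh (y i)) τ xh τm Mb (fun t j => x (max t (-τm)) j / xh j) := by
  obtain ⟨hnn, hcont, hder⟩ := hx
  obtain ⟨B, hB1, hB⟩ : ∃ B, 1 ≤ B ∧ ∀ j, M / xh j ≤ B :=
    exists_unif (fun _ _ _ h1 h2 => h2.trans h1) (fun j => ⟨_, le_rfl⟩)
  have hin : ∀ t, max t (-τm) ∈ Set.Ici (-τm) := fun t => Set.mem_Ici.2 (le_max_right _ _)
  refine ⟨B, ⟨fun i => mul_pos (hk i) (mono_pos' _ _ hxh), hτ, hτm, hτm0, hxh, hbal, ?_, ?_, ?_, hB1, ?_⟩⟩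
  · intro j
    have h1 : Continuous (fun t : ℝ => x (max t (-τm))) :=
      hcont.comp_continuous (continuous_id.max continuous_const) hin
    exact ((continuous_apply j).comp h1).div_const _
  · intro t j
    exact div_pos (hpos _ (hin t) j) (hxh j)
  · intro t j
    exact (div_le_div_of_nonneg_right (hM _ (hin t) j) (hxh j).le).trans (hB j)
  · intro t ht j
    have h1 := ((hasDerivAt_pi.1 (hder t ht)) j).div_const (xh j)
    have h2 : (fun t => x (max t (-τm)) j / xh j) =ᶠ[nhds t] (fun t => x t j / xh j) := by
      filter_upwards [lt_mem_nhds ht] with s hs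
      rw [max_eq_left (by linarith)]
    refine (h1.congr_of_eventuallyEq h2).congr_deriv ?_
    congr 1
    apply Finset.sum_congr rfl
    intro i _
    have e1 := mono_div (x (max t (-τm))) xh (y i) hxh
    have e2 := mono_div (x (max (t - τ i) (-τm))) xh (y i) hxh
    have m1 : max t (-τm) = t := max_eq_left (by linarith)
    have m2 : max (t - τ i) (-τm) = t - τ i := max_eq_left (by linarith [hτm i])
    rw [m1] at e1
    rw [m2] at e2
    rw [m1, m2, ← e1, ← e2]
    ring

theorem stoich_rep (y y' : Fin r → Fin n → ℕ) (A : Finset (Fin r)) (v : Fin n → ℝ) (hv : v ∈ stoichOn y y' A) :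
    ∃ c : Fin r → ℝ, (∀ i ∉ A, c i = 0) ∧ ∀ j, v j = ∑ i, c i * ((y' i j : ℝ) - (y i j : ℝ)) := by
  classical
  unfold stoichOn at hv
  induction hv using Submodule.span_induction with
  | mem v hv =>
    obtain ⟨i, hi, rfl⟩ := hv
    refine ⟨fun i' => if i' = i then 1 else 0, fun i' hi' => ?_, fun j => ?_⟩
    · refine if_neg ?_
      rintro rfl
      exact hi' hi
    · simp
  | zero => exact ⟨fun _ => 0, fun _ _ => rfl, fun j => by simp⟩
  | add v w _ _ h1 h2 =>
    obtain ⟨c, hc, hc2⟩ := h1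
    obtain ⟨d, hd, hd2⟩ := h2
    refine ⟨fun i => c i + d i, fun i hi => by simp [hc i hi, hd i hi], fun j => ?_⟩
    rw [Pi.add_apply, hc2, hd2, ← Finset.sum_add_distrib]
    exact Finset.sum_congr rfl (fun i _ => by ring)
  | smul a v _ h1 =>
    obtain ⟨c, hc, hc2⟩ := h1
    refine ⟨fun i => a * c i, fun i hi => by simp [hc i hi], fun j => ?_⟩
    rw [Pi.smul_apply, hc2, smul_eq_mul, Finset.mul_sum]
    exact Finset.sum_congr rfl (fun i _ => by ring)

theorem comb_inj {l : ℕ} (y y' : Fin r → Fin n → ℕ) (Sp : Fin l → Set (Fin n)) (grp : Fin r → Fin l)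
    (hcomb : IsCombination y y' Sp grp) (W : Set (Fin n)) (hWSc : W ∩ interSpecies Sp = ∅)
    (hc3 : ∀ p, W ∩ Sp p = ∅ ∨ VertexType (stoichOn y y' (Rgrp grp p)) (W ∩ Sp p))
    (A : Finset (Fin r)) (hA : ∀ i ∈ A, ∃ j ∈ W, y i j ≠ 0)
    (v : Fin n → ℝ) (hv : v ∈ stoichOn y y' A) (hvW : ∀ j ∈ W, v j = 0) : v = 0 := by
  classical
  obtain ⟨c, hc, hcv⟩ := stoich_rep y y' A v hv
  set vp : Fin l → Fin n → ℝ := fun p j => ∑ i ∈ Rgrp grp p, c i * ((y' i j : ℝ) - (y i j : ℝ)) with hvp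
  have hsum : ∀ j, v j = ∑ p, vp p j := by
    intro j
    rw [hcv, hvp]
    exact (Finset.sum_fiberwise_of_maps_to (s := Finset.univ) (t := Finset.univ) (g := grp) (fun i _ => Finset.mem_univ _) _).symm
  have hout : ∀ p j, j ∉ Sp p → vp p j = 0 := by
    intro p j hj
    apply Finset.sum_eq_zero
    intro i hi
    have hg : grp i = p := (Finset.mem_filter.1 hi).2
    have e1 : y i j = 0 := by
      by_contra hne; exact hj (hg ▸ hcomb.2 i j (Or.inl hne))
    have e2 : y' i j = 0 := by
      by_contra hne; exact hj (hg ▸ hcomb.2 i j (Or.inr hne))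
    simp [e1, e2]
  have hz : ∀ p, vp p = 0 := by
    intro p
    rcases hc3 p with hemp | hver
    · funext j
      apply Finset.sum_eq_zero
      intro i hi
      have hg : grp i = p := (Finset.mem_filter.1 hi).2
      rw [hc i, zero_mul]
      intro hiA
      obtain ⟨w, hw, hwy⟩ := hA i hiA
      have : w ∈ W ∩ Sp p := ⟨hw, hg ▸ hcomb.2 i w (Or.inl hwy)⟩
      rw [hemp] at this
      exact this
    · apply hver
      · have : vp p = ∑ i ∈ Rgrp grp p, c i • (fun j => (y' i j : ℝ) - (y i j : ℝ)) := by
          funext j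
          simp [hvp]
        rw [this]
        exact Submodule.sum_mem _ (fun i hi => Submodule.smul_mem _ _ (Submodule.subset_span ⟨i, hi, rfl⟩))
      · rintro j ⟨hjW, hjp⟩
        have h1 := hsum j
        rw [hvW j hjW, Finset.sum_eq_single p] at h1
        · exact h1.symm
        · intro q _ hq
          apply hout
          intro hjq
          have : j ∈ W ∩ interSpecies Sp := ⟨hjW, q, p, hq, hjq, hjp⟩
          rw [hWSc] at this
          exact this
        · intro hh1; exact absurd (Finset.mem_univ p) hh1
  funext j
  rw [hsum, Finset.sum_eq_zero (fun p _ => by rw [hz p]; rfl)]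
  rfl

theorem mono_exp (xb η : Fin n → ℝ) (z : Fin n → ℕ) :
    mono (fun j => xb j * Real.exp (η j)) z = mono xb z * Real.exp (∑ j, η j * (z j : ℝ)) := by
  unfold mono
  rw [Real.exp_sum, ← Finset.prod_mul_distrib]
  apply Finset.prod_congr rfl
  intro j _
  rw [mul_pow, ← Real.exp_nat_mul]
  ring_nf

theorem stmt8 {n r l : ℕ} (y y' : Fin r → Fin n → ℕ)
    (k τ : Fin r → ℝ) (τm : ℝ)
    (hk : ∀ i, 0 < k i) (hτ : ∀ i, 0 ≤ τ i) (hτm : ∀ i, τ i ≤ τm) (hτm0 : 0 ≤ τm)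
    (hCB : ComplexBalancedOn y y' k Finset.univ)
    (Sp : Fin l → Set (Fin n)) (grp : Fin r → Fin l)
    (hcomb : IsCombination y y' Sp grp)
    (hsubCB : ∀ p, ComplexBalancedOn y y' k (Rgrp grp p))
    (h2d : ∀ p, Module.finrank ℝ (stoichOn y y' (Rgrp grp p)) = 2)
    (W : Set (Fin n)) (hW : Semilocking y y' Finset.univ W)
    (hWSc : W ∩ interSpecies Sp = ∅)
    (hcaseIII : (∀ p, W ∩ Sp p = ∅ ∨ (Semilocking y y' (Rgrp grp p) (W ∩ Sp p) ∧
        VertexType (stoichOn y y' (Rgrp grp p)) (W ∩ Sp p))) ∧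
      ∃ p, W ∩ Sp p = ∅)
    (hWcv : Wᶜ \ Wcn Sp W = ∅)
    (x : ℝ → Fin n → ℝ) (hx : IsSolution y y' k τ τm x)
    (hxpos : PosInit τm x) (hxbdd : BoundedSol τm x)
    (θ : ℝ → Fin n → ℝ) (hθ : OmegaLimitPt τm x θ) :
    ¬ OnBoundary τm W θ := by
  classical
  intro hB
  obtain ⟨xb, hxb, hcb⟩ := hCB
  obtain ⟨M0, hM0⟩ := hxbdd
  set M := max M0 1 with hM
  have hM1 : 1 ≤ M := le_max_right _ _
  have hxM : ∀ t ∈ Set.Ici (-τm), ∀ j, x t j ≤ M := fun t ht j =>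
    (le_abs_self _).trans ((norm_le_pi_norm (x t) j).trans ((hM0 t ht).trans (le_max_left _ _)))
  have hpos := sol_pos y y' k τ τm hk hτm hτm0 x hx hxpos M hM1 hxM
  have hbal : ∀ f : (Fin n → ℕ) → ℝ, ∑ i, k i * mono xb (y i) * f (y i) = ∑ i, k i * mono xb (y i) * f (y' i) :=
    fun f => cb_bal y y' (fun i => k i * mono xb (y i)) hcb f
  have hKp : ∀ i, 0 < k i * mono xb (y i) := fun i => mul_pos (hk i) (mono_pos' _ _ hxb)
  obtain ⟨Mb, ns⟩ := mkNS y y' k τ τm hk hτ hτm hτm0 x hx hpos M hxM xb hxb hbal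
  obtain ⟨hθc, hθ0, tN, htN, hlim⟩ := hθ
  have h0m : (0:ℝ) ∈ Set.Icc (-τm) 0 := ⟨by linarith, le_rfl⟩
  have hxlim : ∀ j, Tendsto (fun N => x (max (tN N) (-τm)) j) atTop (nhds (θ 0 j)) := by
    intro j
    have h1 : Tendsto (fun N => x (tN N) j) atTop (nhds (θ 0 j)) := by
      rw [Metric.tendsto_atTop]
      intro ε hε
      obtain ⟨N₀, hN₀⟩ := hlim ε hε
      refine ⟨N₀, fun N hN => ?_⟩
      have h2 := hN₀ N hN 0 h0m
      rw [add_zero] at h2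
      exact (norm_le_pi_norm (x (tN N) - θ 0) j).trans_lt h2
    refine h1.congr' ?_
    filter_upwards [htN.eventually_gt_atTop 0] with N hN
    rw [max_eq_left (by linarith)]
  set Wf : Finset (Fin n) := Finset.univ.filter (fun j => j ∈ W) with hWf
  have mW : ∀ j, j ∈ Wf ↔ j ∈ W := fun j => by simp [hWf]
  set A : Finset (Fin r) := Finset.univ.filter (fun i => ∃ j ∈ Wf, y i j ≠ 0) with hAdef
  have hA : ∀ i, i ∈ A ↔ ∃ j ∈ Wf, y i j ≠ 0 := fun i => by simp [hAdef]
  have hA'1 : ∀ i, (∃ j ∈ Wf, y' i j ≠ 0) → i ∈ A := by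
    rintro i ⟨j, hj, hy⟩
    obtain ⟨j2, hj2, hy2⟩ := hW.2 i (Finset.mem_univ i) ⟨j, (mW j).1 hj, hy⟩
    exact (hA i).2 ⟨j2, (mW j2).2 hj2, hy2⟩
  have hA' : ∀ i, i ∈ A ↔ ∃ j ∈ Wf, y' i j ≠ 0 := by
    intro i
    refine ⟨fun hi => ?_, hA'1 i⟩
    by_contra hcon
    have hb := hbal (fun z => if ∃ j ∈ Wf, z j ≠ 0 then 1 else 0)
    have hlt : ∑ i, k i * mono xb (y i) * (if ∃ j ∈ Wf, y' i j ≠ 0 then (1:ℝ) else 0) < ∑ i, k i * mono xb (y i) * (if ∃ j ∈ Wf, y i j ≠ 0 then (1:ℝ) else 0) := by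
      apply Finset.sum_lt_sum
      · intro i' _
        apply mul_le_mul_of_nonneg_left _ (hKp i').le
        by_cases h1 : ∃ j ∈ Wf, y' i' j ≠ 0
        · rw [if_pos h1, if_pos ((hA i').1 (hA'1 i' h1))]
        · rw [if_neg h1]
          split_ifs <;> norm_num
      · refine ⟨i, Finset.mem_univ i, ?_⟩
        rw [if_neg hcon, if_pos ((hA i).1 hi)]
        linarith [hKp i]
    exact absurd hb hlt.ne'
  have hAW : ∀ i ∉ A, ∀ j ∈ Wf, y i j = 0 ∧ y' i j = 0 := by
    intro i hi j hj
    constructor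
    · by_contra h; exact hi ((hA i).2 ⟨j, hj, h⟩)
    · by_contra h; exact hi ((hA' i).2 ⟨j, hj, h⟩)
  have hext : HasExt y y' Wf A := by
    apply hasExt_of y y' Wf A hAW
    intro v hv hv0
    refine comb_inj y y' Sp grp hcomb W hWSc (fun p => (hcaseIII.1 p).imp id And.right) A ?_ v hv
      (fun j hj => hv0 j ((mW j).2 hj))
    intro i hi
    obtain ⟨j, hj, hy⟩ := (hA i).1 hi
    exact ⟨j, (mW j).1 hj, hy⟩
  have θW : ∀ j ∈ Wf, θ 0 j = 0 := fun j hj => hB.1 0 h0m j ((mW j).1 hj)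
  have θC : ∀ j ∉ Wf, 0 < θ 0 j := fun j hj =>
    lt_of_le_of_ne (hθ0 0 h0m j) (Ne.symm (hB.2 0 h0m j (fun h => hj ((mW j).2 h))))
  -- the limit state off W
  set us : Fin n → ℝ := fun j => if j ∈ Wf then 1 else θ 0 j / xb j with hus
  have usp : ∀ j, 0 < us j := by
    intro j
    by_cases hj : j ∈ Wf
    · simp [hus, hj]
    · simp only [hus, if_neg hj]
      exact div_pos (θC j hj) (hxb j)
  have hulim : ∀ z : Fin n → ℕ, Tendsto (fun N => mono (fun j => x (max (tN N) (-τm)) j / xb j) z) atTop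
      (nhds (mono (fun j => θ 0 j / xb j) z)) := fun z =>
    tendsto_finsetProd _ (fun j _ => ((hxlim j).div_const _).pow _)
  have heqm : ∀ i ∉ A, mono us (y i) = mono us (y' i) := by
    intro i hi
    obtain ⟨C, hC1, hC⟩ := ns.core2
    have h1 := (hulim (y i)).sub (hulim (y' i))
    have h2 : Tendsto (fun N => mono (fun j => x (max (tN N) (-τm)) j / xb j) (y i) - mono (fun j => x (max (tN N) (-τm)) j / xb j) (y' i)) atTop (nhds 0) := by
      have h3 : Tendsto (fun N => C * √(qf y (fun i => k i * mono xb (y i)) τ xb τm (fun t j => x (max t (-τm)) j / xb j) (tN N))) atTop (nhds 0) := by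
        have := (ns.e_tendsto.comp htN).const_mul C
        simpa using this
      apply squeeze_zero_norm' _ h3
      filter_upwards [htN.eventually_gt_atTop (τm + 1)] with N hN
      exact (hC _ hN).2.2.2.1 i
    have h4 := tendsto_nhds_unique h1 h2
    have h5 : ∀ z : Fin n → ℕ, (∀ j ∈ Wf, z j = 0) → mono us z = mono (fun j => θ 0 j / xb j) z := by
      intro z hz
      apply Finset.prod_congr rfl
      intro j _
      by_cases hj : j ∈ Wf
      · simp [hz j hj]
      · simp [hus, hj]
    rw [h5 _ (fun j hj => (hAW i hi j hj).1), h5 _ (fun j hj => (hAW i hi j hj).2)]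
    linarith
  obtain ⟨Ce, hCe1, hCe⟩ := hext
  obtain ⟨η, hη0, hη1, hη2⟩ := hCe (fun j => Real.log (us j)) 0 (∑ j, |Real.log (us j)|) le_rfl
    (Finset.sum_nonneg (fun j _ => abs_nonneg _))
    (fun j => Finset.single_le_sum (f := fun j => |Real.log (us j)|) (fun j _ => abs_nonneg _) (Finset.mem_univ j))
    (by
      intro i hi
      have h1 := congrArg Real.log (heqm i hi)
      rw [mono_log _ _ usp, mono_log _ _ usp] at h1
      have h2 : ∑ j, Real.log (us j) * ((y' i j : ℝ) - (y i j : ℝ)) = ∑ j, (y' i j : ℝ) * Real.log (us j) - ∑ j, (y i j : ℝ) * Real.log (us j) := by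
        rw [← Finset.sum_sub_distrib]
        exact Finset.sum_congr rfl (fun j _ => by ring)
      rw [h2, h1, sub_self, abs_zero])
  set xh : Fin n → ℝ := fun j => xb j * Real.exp (η j) with hxhd
  have hxh : ∀ j, 0 < xh j := fun j => mul_pos (hxb j) (Real.exp_pos _)
  have hxhC : ∀ j ∉ Wf, xh j = θ 0 j := by
    intro j hj
    have h1 := hη1 j hj
    rw [mul_zero] at h1
    have h2 : η j = Real.log (us j) := by linarith [abs_nonpos_iff.1 h1]
    rw [hxhd]
    simp only
    rw [h2, Real.exp_log (usp j)]
    simp only [hus, if_neg hj]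
    rw [mul_div_cancel₀ _ (hxb j).ne']
  have hbal2 : ∀ f : (Fin n → ℕ) → ℝ, ∑ i, k i * mono xh (y i) * f (y i) = ∑ i, k i * mono xh (y i) * f (y' i) := by
    intro f
    have h1 := hbal (fun z => Real.exp (∑ j, η j * (z j : ℝ)) * f z)
    have h2 : ∀ i, ∑ j, η j * (y' i j : ℝ) = ∑ j, η j * (y i j : ℝ) := by
      intro i
      have := hη0 i
      simp only [mul_sub, Finset.sum_sub_distrib] at this
      linarith
    simp only [h2] at h1
    calc _ = ∑ i, k i * mono xb (y i) * (Real.exp (∑ j, η j * (y i j : ℝ)) * f (y i)) :=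
          Finset.sum_congr rfl (fun i _ => by rw [hxhd, mono_exp]; ring)
      _ = _ := h1
      _ = _ := Finset.sum_congr rfl (fun i _ => by rw [hxhd, mono_exp]; ring)
  obtain ⟨Mb2, ns2⟩ := mkNS y y' k τ τm hk hτ hτm hτm0 x hx hpos M hxM xh hxh hbal2
  refine Ctx.absurd (W := Wf) (A := A) (tN := tN) ⟨ns2, hA, hA', ?_, ⟨Ce, hCe1, hCe⟩, htN, ?_⟩
  · obtain ⟨w, hw⟩ := hW.1
    exact ⟨w, (mW w).2 hw⟩
  · intro j
    have h1 := (hxlim j).div_const (xh j)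
    by_cases hj : j ∈ Wf
    · rw [if_pos hj]
      rwa [θW j hj, zero_div] at h1
    · rw [if_neg hj]
      rwa [← hxhC j hj, div_self (hxh j).ne'] at h1
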